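/- Assume the anti-concentration hypothesis: c̄ > 0, η > 0, k is a positive even integer, and the inlier matrices {A_i}_{i∈I} are k-certifiably (α²·η²·(1−2c̄)²/(32·c̄), 2c̄, 2M_x)-anti-concentrated. Then every pseudo-distribution μ̃ of level at least k in the variables (ω, x) that satisfies M_{ω,x} at degree 0 obeys (1/|I|)·∑_{i∈I} Ẽ_μ̃[ω_i]·‖v_i − x°‖ ≤ α·η·M_x/2. -/

import Mathlib

open scoped BigOperators
open MvPolynomial

noncomputable section

/-- A polynomial is a sum of squares. -/
def IsSOS {V : Type*} (p : MvPolynomial V ℝ) : Prop :=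
  ∃ (N : ℕ) (q : Fin N → MvPolynomial V ℝ), p = ∑ j, q j ^ 2

/-- A degree-`k` sum-of-squares proof that the system `{A i ≥ 0}` implies `g ≥ 0`:
a family of sos polynomials `P S`, indexed by the subsets `S` of the constraint
indices, with `g = ∑_S P S · ∏_{i∈S} A i` and every summand of degree at most `k`. -/
def SosProof {V ι : Type*} [Fintype ι] [DecidableEq ι]
    (A : ι → MvPolynomial V ℝ) (k : ℕ) (g : MvPolynomial V ℝ) : Prop :=
  ∃ P : Finset ι → MvPolynomial V ℝ,
    (∀ S, IsSOS (P S)) ∧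
    g = ∑ S : Finset ι, P S * ∏ i ∈ S, A i ∧
    ∀ S : Finset ι, (P S * ∏ i ∈ S, A i).totalDegree ≤ k

/-- Pseudo-expectation of `f` under the finitely supported `μ`. -/
def pExpect {V : Type*} (μ : (V → ℝ) →₀ ℝ) (f : (V → ℝ) → ℝ) : ℝ :=
  ∑ z ∈ μ.support, μ z * f z

/-- `μ` is a pseudo-distribution of level `ℓ`: finitely supported, total mass one,
and nonnegative pseudo-expectation on every square of a polynomial of degree `≤ ℓ/2`. -/
def IsPseudoDist {V : Type*} (μ : (V → ℝ) →₀ ℝ) (ℓ : ℕ) : Prop :=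
  (∑ z ∈ μ.support, μ z) = 1 ∧
  ∀ p : MvPolynomial V ℝ, p.totalDegree ≤ ℓ / 2 →
    0 ≤ pExpect μ fun z => MvPolynomial.eval z p ^ 2

/-- A level-`ℓ` pseudo-distribution `μ` satisfies the system `{A i ≥ 0}` at degree `k`. -/
def PDSatisfies {V ι : Type*} [Fintype ι] [DecidableEq ι]
    (μ : (V → ℝ) →₀ ℝ) (ℓ : ℕ) (A : ι → MvPolynomial V ℝ) (k : ℕ) : Prop :=
  ∀ (S : Finset ι) (h : MvPolynomial V ℝ), IsSOS h →
    h.totalDegree + ∑ i ∈ S, max (A i).totalDegree k ≤ ℓ →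
    0 ≤ pExpect μ fun z => MvPolynomial.eval z (h * ∏ i ∈ S, A i)

/-- Euclidean norm of a finite real vector. -/
def enorm {d : ℕ} (v : Fin d → ℝ) : ℝ := Real.sqrt (∑ k, v k ^ 2)

/-- The polynomial `‖A_iᵀ v‖²` in the indeterminate `v ∈ ℝ^{dx}`. -/
def normAPoly {n dx dy : ℕ} (A : Fin n → Matrix (Fin dx) (Fin dy) ℝ) (i : Fin n) :
    MvPolynomial (Fin dx) ℝ :=
  ∑ j, (∑ k, C (A i k j) * X k) ^ 2

/-- The polynomial `‖v‖²` in the indeterminate `v ∈ ℝ^{dx}`. -/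
def vnormPoly (dx : ℕ) : MvPolynomial (Fin dx) ℝ :=
  ∑ k, (X k : MvPolynomial (Fin dx) ℝ) ^ 2

/-- The matrices `{A_i}_{i∈I}` are `k`-certifiably `(Cc, δ, M)`-anti-concentrated:
there is an even univariate polynomial `p` with `p 0 = 1` (evenness witnessed by
`q` with `p(t) = q(t²)`) such that the two anti-concentration inequalities admit
degree-`k` sum-of-squares proofs; `p(‖A_iᵀ v‖)² = q(‖A_iᵀ v‖²)²` as a polynomial in `v`. -/
def AntiConcentrated {n dx dy : ℕ} (A : Fin n → Matrix (Fin dx) (Fin dy) ℝ)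
    (I : Finset (Fin n)) (k : ℕ) (Cc δ M : ℝ) : Prop :=
  ∃ p q : Polynomial ℝ,
    (∀ t : ℝ, p.eval t = q.eval (t ^ 2)) ∧ p.eval 0 = 1 ∧
    (∀ i ∈ I,
      SosProof (fun _ : Fin 1 => C (δ ^ 2) - normAPoly A i) k
        (Polynomial.aeval (normAPoly A i) q ^ 2 - C ((1 - δ) ^ 2))) ∧
    SosProof (fun _ : Fin 1 => C (M ^ 2) - vnormPoly dx) k
      (C (Cc * δ * M ^ 2) -
        vnormPoly dx *
          (C ((I.card : ℝ)⁻¹) * ∑ i ∈ I, Polynomial.aeval (normAPoly A i) q ^ 2))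

/-- The polynomial `‖y_i − A_iᵀ x‖²` in the variables `(ω, x)`. -/
def residPoly {n dx dy : ℕ} (y : Fin n → Fin dy → ℝ)
    (A : Fin n → Matrix (Fin dx) (Fin dy) ℝ) (i : Fin n) :
    MvPolynomial (Fin n ⊕ Fin dx) ℝ :=
  ∑ j, (C (y i j) - ∑ k, C (A i k j) * X (Sum.inr k)) ^ 2

/-- The system `M_{ω,x}`: `ω_i² = ω_i` (two inequalities each),
`c̄² − ω_i·‖y_i − A_iᵀ x‖² ≥ 0`, and the inequalities `g_j(x) ≥ 0` describing `𝕏`. -/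
def sysM {n dx dy mX : ℕ} (y : Fin n → Fin dy → ℝ)
    (A : Fin n → Matrix (Fin dx) (Fin dy) ℝ)
    (g : Fin mX → MvPolynomial (Fin dx) ℝ) (cbar : ℝ) :
    Fin n ⊕ Fin n ⊕ Fin n ⊕ Fin mX → MvPolynomial (Fin n ⊕ Fin dx) ℝ
  | Sum.inl i => X (Sum.inl i) - X (Sum.inl i) ^ 2
  | Sum.inr (Sum.inl i) => X (Sum.inl i) ^ 2 - X (Sum.inl i)
  | Sum.inr (Sum.inr (Sum.inl i)) => C (cbar ^ 2) - X (Sum.inl i) * residPoly y A i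
  | Sum.inr (Sum.inr (Sum.inr j)) => rename Sum.inr (g j)

/-- The system `T_{ω,x}`: `M_{ω,x}` together with `∑ ω_i = αn` (two inequalities). -/
def sysT {n dx dy mX : ℕ} (y : Fin n → Fin dy → ℝ)
    (A : Fin n → Matrix (Fin dx) (Fin dy) ℝ)
    (g : Fin mX → MvPolynomial (Fin dx) ℝ) (cbar α : ℝ) :
    Fin 2 ⊕ (Fin n ⊕ Fin n ⊕ Fin n ⊕ Fin mX) → MvPolynomial (Fin n ⊕ Fin dx) ℝ
  | Sum.inl j =>
      if j = 0 then C (α * n) - ∑ i, X (Sum.inl i)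
      else (∑ i, (X (Sum.inl i) : MvPolynomial (Fin n ⊕ Fin dx) ℝ)) - C (α * n)
  | Sum.inr e => sysM y A g cbar e

/-- The pseudo-expectation `Ẽ_μ[ω_i]`. -/
def Eω {n dx : ℕ} (μ : (Fin n ⊕ Fin dx → ℝ) →₀ ℝ) (i : Fin n) : ℝ :=
  pExpect μ fun z => z (Sum.inl i)

/-- The vector `v_i := Ẽ_μ[ω_i·x] / Ẽ_μ[ω_i]` if `Ẽ_μ[ω_i] > 0`, else `0`. -/
def vEst {n dx : ℕ} (μ : (Fin n ⊕ Fin dx → ℝ) →₀ ℝ) (i : Fin n) : Fin dx → ℝ :=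
  if 0 < Eω μ i then
    fun k => (Eω μ i)⁻¹ * pExpect μ fun z => z (Sum.inl i) * z (Sum.inr k)
  else 0

/-- The estimate `x̂ := ∑_i (Ẽ_μ[ω_i] / ∑_j Ẽ_μ[ω_j]) · v_i`. -/
def xhat {n dx : ℕ} (μ : (Fin n ⊕ Fin dx → ℝ) →₀ ℝ) : Fin dx → ℝ :=
  fun k => ∑ i, Eω μ i / (∑ j, Eω μ j) * vEst μ i k

theorem isSOS_iff_isSumSq {V : Type*} {p : MvPolynomial V ℝ} : IsSOS p ↔ IsSumSq p := by
  constructor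
  · rintro ⟨N, q, rfl⟩
    exact IsSumSq.sum_sq _ _
  · intro h
    induction h with
    | zero => exact ⟨0, fun i => i.elim0, by simp⟩
    | sq_add a _ ih =>
      obtain ⟨N, q, rfl⟩ := ih
      exact ⟨N + 1, Fin.cons a q, by simp [Fin.sum_univ_succ, sq]⟩

namespace IsSOS

variable {V : Type*} {p q : MvPolynomial V ℝ}

theorem sq (p : MvPolynomial V ℝ) : IsSOS (p ^ 2) := ⟨1, fun _ => p, by simp⟩

theorem add (hp : IsSOS p) (hq : IsSOS q) : IsSOS (p + q) :=
  isSOS_iff_isSumSq.2 ((isSOS_iff_isSumSq.1 hp).add (isSOS_iff_isSumSq.1 hq))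

theorem mul (hp : IsSOS p) (hq : IsSOS q) : IsSOS (p * q) :=
  isSOS_iff_isSumSq.2 ((isSOS_iff_isSumSq.1 hp).mul (isSOS_iff_isSumSq.1 hq))

theorem sum {ι : Type*} {s : Finset ι} {f : ι → MvPolynomial V ℝ}
    (h : ∀ i ∈ s, IsSOS (f i)) : IsSOS (∑ i ∈ s, f i) :=
  isSOS_iff_isSumSq.2 (IsSumSq.sum fun i hi => isSOS_iff_isSumSq.1 (h i hi))

theorem sum_sq {ι : Type*} (s : Finset ι) (f : ι → MvPolynomial V ℝ) :
    IsSOS (∑ i ∈ s, f i ^ 2) :=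
  sum fun i _ => sq (f i)

theorem one : IsSOS (1 : MvPolynomial V ℝ) := by
  simpa using sq (1 : MvPolynomial V ℝ)

theorem aeval {W : Type*} (hp : IsSOS p) (f : V → MvPolynomial W ℝ) :
    IsSOS (MvPolynomial.aeval f p) := by
  obtain ⟨N, q, rfl⟩ := hp
  exact ⟨N, fun j => MvPolynomial.aeval f (q j), by simp⟩

theorem eval_nonneg (hp : IsSOS p) (x : V → ℝ) : 0 ≤ MvPolynomial.eval x p := by
  obtain ⟨N, q, rfl⟩ := hp
  simp only [map_sum, map_pow]
  positivity

end IsSOS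

theorem MvPolynomial.totalDegree_aeval_le {V W : Type*} {f : V → MvPolynomial W ℝ}
    (hf : ∀ v, (f v).totalDegree ≤ 1) (p : MvPolynomial V ℝ) :
    (MvPolynomial.aeval f p).totalDegree ≤ p.totalDegree := by
  rw [MvPolynomial.aeval_def, MvPolynomial.eval₂_eq]
  refine totalDegree_finsetSum_le fun d hd => ?_
  refine (totalDegree_mul _ _).trans ?_
  rw [MvPolynomial.algebraMap_eq, totalDegree_C, zero_add]
  refine (totalDegree_finsetProd _ _).trans ?_
  refine le_trans (Finset.sum_le_sum fun i _ => ?_) (le_totalDegree hd)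
  refine (totalDegree_pow _ _).trans ?_
  simpa using Nat.mul_le_mul_left (d i) (hf i)

theorem MvPolynomial.totalDegree_polynomial_aeval_le {V : Type*} (s : MvPolynomial V ℝ)
    (p : Polynomial ℝ) :
    (Polynomial.aeval s p).totalDegree ≤ p.natDegree * s.totalDegree := by
  rw [Polynomial.aeval_eq_sum_range]
  refine totalDegree_finsetSum_le fun i hi => ?_
  refine (totalDegree_smul_le _ _).trans ((totalDegree_pow _ _).trans ?_)
  exact Nat.mul_le_mul_right _ (by simpa [Nat.lt_succ_iff] using hi)

open Polynomial in
/-- A linear functional that is nonnegative on the elements `X ^ a * (R - X) ^ b * τ ^ 2` of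
degree at most `m` is nonnegative on every polynomial of degree at most `m` which is
nonnegative on `[0, R]`. -/
theorem Polynomial.linearMap_nonneg_of_nonneg_on_Icc {R : ℝ} (hR : 0 < R) (m : ℕ)
    (L : ℝ[X] →ₗ[ℝ] ℝ)
    (hL : ∀ (a b : ℕ) (τ : ℝ[X]), a + b + 2 * τ.natDegree ≤ m →
      0 ≤ L (X ^ a * (C R - X) ^ b * τ ^ 2))
    {f : ℝ[X]} (hdeg : f.natDegree ≤ m) (hf : ∀ t ∈ Set.Icc 0 R, 0 ≤ f.eval t) : 0 ≤ L f := by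
  have closed : ∀ (g : ℝ[X]) (r : ℝ), r ∈ Set.Icc 0 R →
      (∀ t ∈ Set.Icc 0 R, t ≠ r → 0 ≤ g.eval t) → 0 ≤ g.eval r := by
    intro g r hr h
    have hd : r ∈ closure (Set.Ioo 0 R \ {r}) := by
      have h1 : r ∈ closure (Set.Ioo 0 R) := by rwa [closure_Ioo hR.ne]
      by_contra h2
      rw [mem_closure_iff] at h1
      rw [mem_closure_iff] at h2
      push Not at h2
      obtain ⟨o, ho, hro, he⟩ := h2
      have hsub : o ∩ Set.Ioo 0 R ⊆ {r} := by
        intro t ht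
        by_contra hne
        have : t ∈ o ∩ (Set.Ioo 0 R \ {r}) := ⟨ht.1, ht.2, hne⟩
        simp [he] at this
      have hopen : IsOpen (o ∩ Set.Ioo 0 R) := ho.inter isOpen_Ioo
      have hfin := (Set.finite_singleton r).subset hsub
      obtain ⟨t, ht⟩ := h1 o ho hro
      exact (infinite_of_mem_nhds t (hopen.mem_nhds ht)) hfin
    have hcl : IsClosed {t : ℝ | 0 ≤ g.eval t} := isClosed_le continuous_const g.continuous
    exact closure_minimal
      (fun t ht => h t ⟨ht.1.1.le, ht.1.2.le⟩ (by simpa using ht.2)) hcl hd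
  have main : ∀ (d : ℕ) (f : ℝ[X]) (a b : ℕ) (τ : ℝ[X]), f.natDegree ≤ d →
      a + b + 2 * τ.natDegree + d ≤ m → (∀ t ∈ Set.Icc 0 R, 0 ≤ f.eval t) →
      0 ≤ L (X ^ a * (C R - X) ^ b * τ ^ 2 * f) := by
    intro d
    induction d using Nat.strong_induction_on with
    | _ d ih =>
    intro f a b τ hfd hd hf
    rcases Nat.eq_zero_or_pos f.natDegree with h0 | hpos
    · obtain ⟨c, rfl⟩ : ∃ c, f = C c := ⟨_, eq_C_of_natDegree_eq_zero h0⟩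
      have hc : 0 ≤ c := by simpa using hf 0 ⟨le_rfl, hR.le⟩
      rw [mul_comm, ← smul_eq_C_mul, map_smul]
      exact mul_nonneg hc (hL a b τ (by omega))
    · have hf0 : f ≠ 0 := by rintro rfl; simp at hpos
      obtain ⟨z, hz⟩ : ∃ z : ℂ, aeval z f = 0 := by
        obtain ⟨z, hz⟩ := Complex.exists_root (f := f.map (algebraMap ℝ ℂ))
          (by rw [degree_map]; exact natDegree_pos_iff_degree_pos.1 hpos)
        exact ⟨z, by rw [aeval_def, eval₂_eq_eval_map]; exact hz⟩
      by_cases him : z.im = 0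
      · obtain ⟨r, rfl⟩ : ∃ r : ℝ, z = r := ⟨z.re, by apply Complex.ext <;> simp [him]⟩
        have hr : f.IsRoot r := by
          have : ((f.eval r : ℝ) : ℂ) = 0 := by
            rw [← hz]
            simp [aeval_def, eval₂_at_apply, ← Complex.coe_algebraMap]
          exact_mod_cast this
        obtain ⟨g, rfl⟩ := dvd_iff_isRoot.2 hr
        have hg0 : g ≠ 0 := by rintro rfl; simp at hf0
        have hdg : ((X - C r) * g).natDegree = g.natDegree + 1 := by
          rw [natDegree_mul (X_sub_C_ne_zero r) hg0, natDegree_X_sub_C, add_comm]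
        rw [hdg] at hfd
        simp only [eval_mul, eval_sub, eval_X, eval_C] at hf
        rcases le_or_gt r 0 with hr0 | hr0
        · have hg : ∀ t ∈ Set.Icc 0 R, 0 ≤ g.eval t := by
            have : ∀ t ∈ Set.Icc 0 R, t ≠ 0 → 0 ≤ g.eval t := fun t ht h0 => by
              have : 0 < t := lt_of_le_of_ne ht.1 (Ne.symm h0)
              exact nonneg_of_mul_nonneg_right (hf t ht) (by linarith)
            intro t ht
            by_cases h : t = 0
            · subst h
              exact closed g 0 ht this
            · exact this t ht h
          have h1 := ih g.natDegree (by omega) g (a + 1) b τ le_rfl (by omega) hg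
          have h2 := ih g.natDegree (by omega) g a b τ le_rfl (by omega) hg
          have : X ^ a * (C R - X) ^ b * τ ^ 2 * ((X - C r) * g) =
              X ^ (a + 1) * (C R - X) ^ b * τ ^ 2 * g +
                (-r) • (X ^ a * (C R - X) ^ b * τ ^ 2 * g) := by
            rw [smul_eq_C_mul, C_neg]; ring
          rw [this, map_add, map_smul]
          exact add_nonneg h1 (mul_nonneg (by linarith) h2)
        rcases le_or_gt R r with hrR | hrR
        · have hg : ∀ t ∈ Set.Icc 0 R, 0 ≤ (-g).eval t := by
            have : ∀ t ∈ Set.Icc 0 R, t ≠ R → 0 ≤ (-g).eval t := fun t ht h0 => by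
              have : t < R := lt_of_le_of_ne ht.2 h0
              have h1 := hf t ht
              rw [eval_neg]
              by_contra! h
              nlinarith
            intro t ht
            by_cases h : t = R
            · subst h
              exact closed (-g) t ht this
            · exact this t ht h
          have h1 := ih g.natDegree (by omega) (-g) a (b + 1) τ (by simp) (by omega) hg
          have h2 := ih g.natDegree (by omega) (-g) a b τ (by simp) (by omega) hg
          have : X ^ a * (C R - X) ^ b * τ ^ 2 * ((X - C r) * g) =
              X ^ a * (C R - X) ^ (b + 1) * τ ^ 2 * (-g) +
                (r - R) • (X ^ a * (C R - X) ^ b * τ ^ 2 * (-g)) := by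
            rw [smul_eq_C_mul, C_sub]; ring
          rw [this, map_add, map_smul]
          exact add_nonneg h1 (mul_nonneg (by linarith) h2)
        · have hgr : g.eval r = 0 := by
            have hge : 0 ≤ g.eval r := by
              have hcl : IsClosed {t : ℝ | 0 ≤ g.eval t} :=
                isClosed_le continuous_const g.continuous
              have hd : r ∈ closure (Set.Ioo r R) := by
                rw [closure_Ioo hrR.ne]; exact ⟨le_rfl, hrR.le⟩
              refine closure_minimal (fun t ht => ?_) hcl hd
              exact nonneg_of_mul_nonneg_right (hf t ⟨by linarith [ht.1], ht.2.le⟩)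
                (by linarith [ht.1])
            have hle : g.eval r ≤ 0 := by
              have hcl : IsClosed {t : ℝ | g.eval t ≤ 0} :=
                isClosed_le g.continuous continuous_const
              have hd : r ∈ closure (Set.Ioo 0 r) := by
                rw [closure_Ioo hr0.ne]; exact ⟨hr0.le, le_rfl⟩
              refine closure_minimal (fun t ht => ?_) hcl hd
              have h1 := hf t ⟨ht.1.le, by linarith [ht.2]⟩
              have h2 := ht.2
              change g.eval t ≤ 0
              by_contra! h
              nlinarith
            exact le_antisymm hle hge
          obtain ⟨h, rfl⟩ := dvd_iff_isRoot.2 hgr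
          have hh0 : h ≠ 0 := by rintro rfl; simp at hg0
          have hdh : ((X - C r) * h).natDegree = h.natDegree + 1 := by
            rw [natDegree_mul (X_sub_C_ne_zero r) hh0, natDegree_X_sub_C, add_comm]
          rw [hdh] at hfd
          simp only [eval_mul, eval_sub, eval_X, eval_C] at hf
          have hh : ∀ t ∈ Set.Icc 0 R, 0 ≤ h.eval t := by
            have : ∀ t ∈ Set.Icc 0 R, t ≠ r → 0 ≤ h.eval t := fun t ht h0 => by
              have h1 := hf t ht
              rw [← mul_assoc, ← sq] at h1
              exact nonneg_of_mul_nonneg_right h1 (by have := sub_ne_zero.2 h0; positivity)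
            intro t ht
            by_cases h' : t = r
            · subst h'
              exact closed h t ht this
            · exact this t ht h'
          have hτ : ((X - C r) * τ).natDegree ≤ τ.natDegree + 1 :=
            natDegree_mul_le.trans (by rw [natDegree_X_sub_C, add_comm])
          have h1 := ih h.natDegree (by omega) h a b ((X - C r) * τ) le_rfl (by omega) hh
          convert h1 using 2
          ring
      · obtain ⟨g, rfl⟩ := quadratic_dvd_of_aeval_eq_zero_im_ne_zero f hz him
        have hq : X ^ 2 - C (2 * z.re) * X + C (‖z‖ ^ 2) =
            (X - C z.re) ^ 2 + C z.im ^ 2 := by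
          rw [Complex.sq_norm, Complex.normSq_apply]
          simp only [C_mul, C_add, C_ofNat]
          ring
        rw [hq] at hf hf0 hfd ⊢
        have hg0 : g ≠ 0 := by rintro rfl; simp at hf0
        have hqd : ((X - C z.re) ^ 2 + C z.im ^ 2).natDegree = 2 := by
          rw [← C_pow, natDegree_add_C, natDegree_pow, natDegree_X_sub_C]
        rw [natDegree_mul (by rintro h; simp [h] at hqd) hg0, hqd] at hfd
        have hg : ∀ t ∈ Set.Icc 0 R, 0 ≤ g.eval t := fun t ht => by
          have h1 := hf t ht
          rw [eval_mul] at h1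
          refine nonneg_of_mul_nonneg_right h1 ?_
          simp only [eval_add, eval_pow, eval_sub, eval_X, eval_C]
          positivity
        have hτ : ((X - C z.re) * τ).natDegree ≤ τ.natDegree + 1 :=
          natDegree_mul_le.trans (by rw [natDegree_X_sub_C, add_comm])
        have hτ' : (C z.im * τ).natDegree ≤ τ.natDegree := natDegree_C_mul_le _ _
        have h1 := ih g.natDegree (by omega) g a b ((X - C z.re) * τ) le_rfl (by omega) hg
        have h2 := ih g.natDegree (by omega) g a b (C z.im * τ) le_rfl (by omega) hg
        have : X ^ a * (C R - X) ^ b * τ ^ 2 * (((X - C z.re) ^ 2 + C z.im ^ 2) * g) =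
            X ^ a * (C R - X) ^ b * ((X - C z.re) * τ) ^ 2 * g +
              X ^ a * (C R - X) ^ b * (C z.im * τ) ^ 2 * g := by ring
        rw [this, map_add]
        exact add_nonneg h1 h2
  simpa using main f.natDegree f 0 0 1 le_rfl (by simpa using hdeg) hf

section Degree

variable {V : Type*} {p q : MvPolynomial V ℝ} {a b : ℕ}

theorem totalDegree_mul_le_of_le (hp : p.totalDegree ≤ a) (hq : q.totalDegree ≤ b) :
    (p * q).totalDegree ≤ a + b :=
  (totalDegree_mul _ _).trans (add_le_add hp hq)

theorem totalDegree_add_le_of_le (hp : p.totalDegree ≤ a) (hq : q.totalDegree ≤ a) :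
    (p + q).totalDegree ≤ a :=
  (totalDegree_add _ _).trans (max_le hp hq)

theorem totalDegree_sub_le_of_le (hp : p.totalDegree ≤ a) (hq : q.totalDegree ≤ a) :
    (p - q).totalDegree ≤ a :=
  (totalDegree_sub _ _).trans (max_le hp hq)

theorem totalDegree_sq_le_of_le (hp : p.totalDegree ≤ a) : (p ^ 2).totalDegree ≤ 2 * a :=
  (totalDegree_pow _ _).trans (Nat.mul_le_mul_left _ hp)

theorem totalDegree_C_le (c : ℝ) : (C c : MvPolynomial V ℝ).totalDegree ≤ a := by
  simp

theorem totalDegree_C_mul_le (c : ℝ) (hp : p.totalDegree ≤ a) : (C c * p).totalDegree ≤ a := by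
  simpa using totalDegree_mul_le_of_le (totalDegree_C_le (a := 0) c) hp

theorem totalDegree_one_le : (1 : MvPolynomial V ℝ).totalDegree ≤ a := by
  simp

end Degree

/-- The pseudo-expectation as a linear functional on polynomials. -/
def polyExpect {V : Type*} (μ : (V → ℝ) →₀ ℝ) : MvPolynomial V ℝ →ₗ[ℝ] ℝ where
  toFun p := pExpect μ fun z => eval z p
  map_add' p q := by simp [pExpect, mul_add, Finset.sum_add_distrib]
  map_smul' c p := by
    simp only [pExpect, smul_eval, RingHom.id_apply, smul_eq_mul, Finset.mul_sum]
    exact Finset.sum_congr rfl fun z _ => by ring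

theorem polyExpect_C_mul {V : Type*} (μ : (V → ℝ) →₀ ℝ) (c : ℝ) (p : MvPolynomial V ℝ) :
    polyExpect μ (C c * p) = c * polyExpect μ p := by
  rw [← smul_eq_C_mul, map_smul, smul_eq_mul]

section Setup

variable {n dx dy mX : ℕ}

/-- The indicator variable `ω_i`. -/
abbrev indVar (dx : ℕ) (i : Fin n) : MvPolynomial (Fin n ⊕ Fin dx) ℝ := X (Sum.inl i)

/-- The coordinates of the error `x - x0`. -/
def errVar (n : ℕ) (x0 : Fin dx → ℝ) (k : Fin dx) : MvPolynomial (Fin n ⊕ Fin dx) ℝ :=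
  X (Sum.inr k) - C (x0 k)

/-- The polynomial `‖x - x0‖²`. -/
def errSq (n : ℕ) (x0 : Fin dx → ℝ) : MvPolynomial (Fin n ⊕ Fin dx) ℝ :=
  ∑ k, errVar n x0 k ^ 2

/-- The polynomial `‖A_iᵀ (x - x0)‖²`. -/
def measSq (A : Fin n → Matrix (Fin dx) (Fin dy) ℝ) (x0 : Fin dx → ℝ) (i : Fin n) :
    MvPolynomial (Fin n ⊕ Fin dx) ℝ :=
  ∑ j, (∑ k, C (A i k j) * errVar n x0 k) ^ 2

/-- The polynomial `‖x‖²`. -/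
def ptSq (n dx : ℕ) : MvPolynomial (Fin n ⊕ Fin dx) ℝ :=
  ∑ k, X (Sum.inr k) ^ 2

theorem totalDegree_indVar (i : Fin n) : (indVar dx i).totalDegree ≤ 1 := (totalDegree_X _).le

theorem totalDegree_errVar (x0 : Fin dx → ℝ) (k : Fin dx) :
    (errVar n x0 k).totalDegree ≤ 1 :=
  totalDegree_sub_le_of_le (by simp) (totalDegree_C_le _)

theorem totalDegree_errSq (x0 : Fin dx → ℝ) : (errSq n x0).totalDegree ≤ 2 :=
  totalDegree_finsetSum_le fun k _ => totalDegree_sq_le_of_le (totalDegree_errVar x0 k)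

theorem totalDegree_measSq (A : Fin n → Matrix (Fin dx) (Fin dy) ℝ) (x0 : Fin dx → ℝ)
    (i : Fin n) : (measSq A x0 i).totalDegree ≤ 2 :=
  totalDegree_finsetSum_le fun _ _ => totalDegree_sq_le_of_le <|
    totalDegree_finsetSum_le fun k _ => totalDegree_C_mul_le _ (totalDegree_errVar x0 k)

theorem totalDegree_ptSq : (ptSq n dx).totalDegree ≤ 2 :=
  totalDegree_finsetSum_le fun _ _ => totalDegree_sq_le_of_le (totalDegree_X _).le

theorem totalDegree_residPoly (y : Fin n → Fin dy → ℝ)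
    (A : Fin n → Matrix (Fin dx) (Fin dy) ℝ) (i : Fin n) :
    (residPoly y A i).totalDegree ≤ 2 :=
  totalDegree_finsetSum_le fun _ _ => totalDegree_sq_le_of_le <|
    totalDegree_sub_le_of_le (totalDegree_C_le _) <|
    totalDegree_finsetSum_le fun _ _ => totalDegree_C_mul_le _ (totalDegree_X _).le

theorem isSOS_errSq (x0 : Fin dx → ℝ) : IsSOS (errSq n x0) := IsSOS.sum_sq _ _

theorem isSOS_measSq (A : Fin n → Matrix (Fin dx) (Fin dy) ℝ) (x0 : Fin dx → ℝ)
    (i : Fin n) : IsSOS (measSq A x0 i) := IsSOS.sum_sq _ _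

variable {y : Fin n → Fin dy → ℝ} {A : Fin n → Matrix (Fin dx) (Fin dy) ℝ}
  {g : Fin mX → MvPolynomial (Fin dx) ℝ} {cbar : ℝ} {ℓ : ℕ}
  {μ : (Fin n ⊕ Fin dx → ℝ) →₀ ℝ}

theorem polyExpect_nonneg (hsat : PDSatisfies μ ℓ (sysM y A g cbar) 0)
    {h : MvPolynomial (Fin n ⊕ Fin dx) ℝ} (hh : IsSOS h) (hd : h.totalDegree ≤ ℓ) :
    0 ≤ polyExpect μ h := by
  simpa [polyExpect] using hsat ∅ h hh (by simpa using hd)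

theorem polyExpect_mul_nonneg (hsat : PDSatisfies μ ℓ (sysM y A g cbar) 0)
    {h : MvPolynomial (Fin n ⊕ Fin dx) ℝ} (hh : IsSOS h)
    (e : Fin n ⊕ Fin n ⊕ Fin n ⊕ Fin mX) {d : ℕ} (he : (sysM y A g cbar e).totalDegree ≤ d)
    (hd : h.totalDegree + d ≤ ℓ) : 0 ≤ polyExpect μ (h * sysM y A g cbar e) := by
  simpa [polyExpect] using hsat {e} h hh (by simpa using by omega)

theorem polyExpect_bool_sos (hsat : PDSatisfies μ ℓ (sysM y A g cbar) 0)
    {h : MvPolynomial (Fin n ⊕ Fin dx) ℝ} (hh : IsSOS h) (hd : h.totalDegree + 2 ≤ ℓ)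
    (i : Fin n) : polyExpect μ (h * (indVar dx i - indVar dx i ^ 2)) = 0 := by
  have hw : (indVar dx i).totalDegree ≤ 2 := (totalDegree_indVar i).trans (by norm_num)
  have hw2 : (indVar dx i ^ 2).totalDegree ≤ 2 := totalDegree_sq_le_of_le (totalDegree_indVar i)
  have h1 := polyExpect_mul_nonneg hsat hh (Sum.inl i) (totalDegree_sub_le_of_le hw hw2) hd
  have h2 := polyExpect_mul_nonneg hsat hh (Sum.inr (Sum.inl i))
    (totalDegree_sub_le_of_le hw2 hw) hd
  simp only [sysM] at h1 h2
  have h3 : h * (indVar dx i ^ 2 - indVar dx i) = -(h * (indVar dx i - indVar dx i ^ 2)) := by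
    ring
  rw [h3, map_neg] at h2
  exact le_antisymm (by linarith) h1

theorem polyExpect_bool (hsat : PDSatisfies μ ℓ (sysM y A g cbar) 0)
    {h p : MvPolynomial (Fin n ⊕ Fin dx) ℝ} (hh : IsSOS h) {d e : ℕ}
    (hd : h.totalDegree ≤ d) (he : p.totalDegree ≤ e) (hℓ : d + 2 * e + 2 ≤ ℓ)
    (i : Fin n) : polyExpect μ (h * p * (indVar dx i - indVar dx i ^ 2)) = 0 := by
  have key : ∀ q : MvPolynomial (Fin n ⊕ Fin dx) ℝ, q.totalDegree ≤ e →
      polyExpect μ (h * q ^ 2 * (indVar dx i - indVar dx i ^ 2)) = 0 := fun q hq =>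
    polyExpect_bool_sos hsat (hh.mul (IsSOS.sq q))
      (by have := totalDegree_mul_le_of_le hd (totalDegree_sq_le_of_le hq); omega) i
  have h1 := key _ (totalDegree_add_le_of_le he totalDegree_one_le)
  have h2 := key _ (totalDegree_sub_le_of_le he totalDegree_one_le)
  have h3 : h * (p + 1) ^ 2 * (indVar dx i - indVar dx i ^ 2) -
      h * (p - 1) ^ 2 * (indVar dx i - indVar dx i ^ 2) =
        C 4 * (h * p * (indVar dx i - indVar dx i ^ 2)) := by
    rw [map_ofNat]; ring
  have h4 := congrArg (polyExpect μ) h3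
  rw [map_sub, polyExpect_C_mul, h1, h2] at h4
  linarith

theorem polyExpect_ind_mul_nonneg (hsat : PDSatisfies μ ℓ (sysM y A g cbar) 0)
    {h : MvPolynomial (Fin n ⊕ Fin dx) ℝ} (hh : IsSOS h) (hd : h.totalDegree + 2 ≤ ℓ)
    (i : Fin n) : 0 ≤ polyExpect μ (indVar dx i * h) := by
  have h1 := polyExpect_bool_sos hsat hh hd i
  have h2 := polyExpect_nonneg hsat ((IsSOS.sq (indVar dx i)).mul hh)
    (by have := totalDegree_mul_le_of_le (totalDegree_sq_le_of_le (totalDegree_indVar i))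
          le_rfl (q := h); omega)
  have h3 : indVar dx i * h = h * (indVar dx i - indVar dx i ^ 2) + indVar dx i ^ 2 * h := by
    ring
  rw [h3, map_add]
  linarith

theorem polyExpect_one_sub_ind_mul_nonneg (hsat : PDSatisfies μ ℓ (sysM y A g cbar) 0)
    {h : MvPolynomial (Fin n ⊕ Fin dx) ℝ} (hh : IsSOS h) (hd : h.totalDegree + 2 ≤ ℓ)
    (i : Fin n) : 0 ≤ polyExpect μ ((1 - indVar dx i) * h) := by
  have h1 := polyExpect_bool_sos hsat hh hd i
  have h2 := polyExpect_nonneg hsat ((IsSOS.sq (1 - indVar dx i)).mul hh)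
    (by have := totalDegree_mul_le_of_le (totalDegree_sq_le_of_le
          (totalDegree_sub_le_of_le (totalDegree_one_le) (totalDegree_indVar (dx := dx) i)))
          le_rfl (q := h); omega)
  have h3 : (1 - indVar dx i) * h =
      h * (indVar dx i - indVar dx i ^ 2) + (1 - indVar dx i) ^ 2 * h := by ring
  rw [h3, map_add]
  linarith

theorem measSq_eq (i : Fin n) (x0 : Fin dx → ℝ) :
    measSq A x0 i = C 2 * residPoly y A i +
      C (2 * ∑ j, (y i j - ∑ k, A i k j * x0 k) ^ 2) -
      ∑ j, ((C (y i j) - ∑ k, C (A i k j) * X (Sum.inr k)) +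
        C (y i j - ∑ k, A i k j * x0 k)) ^ 2 := by
  simp only [measSq, residPoly, errVar, C_mul, map_sum, Finset.mul_sum,
    ← Finset.sum_add_distrib, ← Finset.sum_sub_distrib, C_pow, C_sub, map_ofNat, mul_sub]
  refine Finset.sum_congr rfl fun j _ => ?_
  rw [Finset.sum_sub_distrib]
  ring

/-- Multiplying the residual constraint of an inlier by an sos polynomial of small degree. -/
theorem polyExpect_mul_measSq_nonneg (hsat : PDSatisfies μ ℓ (sysM y A g cbar) 0)
    {h : MvPolynomial (Fin n ⊕ Fin dx) ℝ} (hh : IsSOS h) (hd : h.totalDegree + 4 ≤ ℓ)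
    {x0 : Fin dx → ℝ} {i : Fin n}
    (hi : ∑ j, (y i j - ∑ k, A i k j * x0 k) ^ 2 ≤ cbar ^ 2) :
    0 ≤ polyExpect μ (h * (C ((2 * cbar) ^ 2) - indVar dx i * measSq A x0 i)) := by
  set ρ := ∑ j, (y i j - ∑ k, A i k j * x0 k) ^ 2 with hρ
  set T : MvPolynomial (Fin n ⊕ Fin dx) ℝ :=
    ∑ j, ((C (y i j) - ∑ k, C (A i k j) * X (Sum.inr k)) +
        C (y i j - ∑ k, A i k j * x0 k)) ^ 2 with hT
  have hTd : T.totalDegree ≤ 2 :=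
    totalDegree_finsetSum_le fun j _ => totalDegree_sq_le_of_le <|
    totalDegree_add_le_of_le (totalDegree_sub_le_of_le (totalDegree_C_le _) <|
    totalDegree_finsetSum_le fun k _ => totalDegree_C_mul_le _ (totalDegree_X _).le)
    (totalDegree_C_le _)
  have hTs : IsSOS T := IsSOS.sum_sq _ _
  have hc : (sysM y A g cbar (Sum.inr (Sum.inr (Sum.inl i)))).totalDegree ≤ 3 :=
    totalDegree_sub_le_of_le (totalDegree_C_le _)
      (totalDegree_mul_le_of_le (totalDegree_indVar i) (totalDegree_residPoly y A i))
  have h1 := polyExpect_mul_nonneg hsat hh (Sum.inr (Sum.inr (Sum.inl i))) hc (by omega)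
  simp only [sysM] at h1
  have h2 := polyExpect_one_sub_ind_mul_nonneg hsat hh (by omega) i
  have h3 := polyExpect_ind_mul_nonneg hsat hh (by omega) i
  have h4 := polyExpect_ind_mul_nonneg hsat (hh.mul hTs)
    (by have := totalDegree_mul_le_of_le (le_refl h.totalDegree) hTd; omega) i
  have key : h * (C ((2 * cbar) ^ 2) - indVar dx i * measSq A x0 i) =
      C 2 * (h * (C (cbar ^ 2) - indVar dx i * residPoly y A i)) +
      C (2 * cbar ^ 2) * ((1 - indVar dx i) * h) +
      C (2 * (cbar ^ 2 - ρ)) * (indVar dx i * h) + indVar dx i * (h * T) := by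
    rw [measSq_eq (y := y), ← hρ, ← hT]
    simp only [C_mul, C_sub, C_pow, map_ofNat]
    ring
  rw [key]
  simp only [map_add, polyExpect_C_mul]
  have := mul_nonneg (sub_nonneg.2 hi) h3
  nlinarith [mul_nonneg (sq_nonneg cbar) h2]

section Ball

variable {Mx : ℝ} {j0 : Fin mX}

theorem sysM_ball (hj0 : g j0 = C (Mx ^ 2) - vnormPoly dx) :
    sysM y A g cbar (Sum.inr (Sum.inr (Sum.inr j0))) = C (Mx ^ 2) - ptSq n dx := by
  simp [sysM, hj0, vnormPoly, ptSq]

theorem totalDegree_ball (Mx : ℝ) : (C (Mx ^ 2) - ptSq n dx).totalDegree ≤ 2 :=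
  totalDegree_sub_le_of_le (totalDegree_C_le _) totalDegree_ptSq

theorem polyExpect_mul_ball_nonneg (hsat : PDSatisfies μ ℓ (sysM y A g cbar) 0)
    (hj0 : g j0 = C (Mx ^ 2) - vnormPoly dx)
    {h : MvPolynomial (Fin n ⊕ Fin dx) ℝ} (hh : IsSOS h) (hd : h.totalDegree + 2 ≤ ℓ) :
    0 ≤ polyExpect μ (h * (C (Mx ^ 2) - ptSq n dx)) := by
  have he := sysM_ball (y := y) (A := A) (cbar := cbar) hj0
  rw [← he]
  exact polyExpect_mul_nonneg hsat hh _ (by rw [he]; exact totalDegree_ball Mx) hd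

theorem polyExpect_one_sub_ind_mul_ball_nonneg (hsat : PDSatisfies μ ℓ (sysM y A g cbar) 0)
    (hj0 : g j0 = C (Mx ^ 2) - vnormPoly dx) (hℓ : 4 ≤ ℓ) (i : Fin n) :
    0 ≤ polyExpect μ ((1 - indVar dx i) * (C (Mx ^ 2) - ptSq n dx)) := by
  have he := sysM_ball (y := y) (A := A) (cbar := cbar) hj0
  have hdw := totalDegree_sub_le_of_le (totalDegree_one_le) (totalDegree_indVar (dx := dx) i)
  have h1 := polyExpect_mul_ball_nonneg hsat hj0 (IsSOS.sq (1 - indVar dx i))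
    (by have := totalDegree_sq_le_of_le hdw; omega)
  have h2 : 0 ≤ polyExpect μ
      ((indVar dx i - indVar dx i ^ 2) * (C (Mx ^ 2) - ptSq n dx)) := by
    have hw2 : (indVar dx i - indVar dx i ^ 2).totalDegree ≤ 2 :=
      totalDegree_sub_le_of_le ((totalDegree_indVar i).trans (by norm_num))
        (totalDegree_sq_le_of_le (totalDegree_indVar i))
    have hb := totalDegree_ball (n := n) (dx := dx) Mx
    have hne : (Sum.inl i : Fin n ⊕ Fin n ⊕ Fin n ⊕ Fin mX) ∉
      ({Sum.inr (Sum.inr (Sum.inr j0))} : Finset _) := by simp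
    have h := hsat {Sum.inl i, Sum.inr (Sum.inr (Sum.inr j0))} 1 IsSOS.one (by
      rw [Finset.sum_insert hne, Finset.sum_singleton, he]
      simp only [sysM, totalDegree_one, Nat.max_zero, zero_add]
      exact (add_le_add hw2 hb).trans hℓ)
    rw [Finset.prod_insert hne, Finset.prod_singleton, he, one_mul] at h
    exact h
  have h3 : (1 - indVar dx i) * (C (Mx ^ 2) - ptSq n dx) =
      (1 - indVar dx i) ^ 2 * (C (Mx ^ 2) - ptSq n dx) +
      (indVar dx i - indVar dx i ^ 2) * (C (Mx ^ 2) - ptSq n dx) := by ring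
  rw [h3, map_add]
  exact add_nonneg h1 h2

theorem polyExpect_mul_errSq_ball_nonneg (hsat : PDSatisfies μ ℓ (sysM y A g cbar) 0)
    (hj0 : g j0 = C (Mx ^ 2) - vnormPoly dx) {x0 : Fin dx → ℝ} (hx0 : ∑ k, x0 k ^ 2 ≤ Mx ^ 2)
    {h : MvPolynomial (Fin n ⊕ Fin dx) ℝ} (hh : IsSOS h) (hd : h.totalDegree + 2 ≤ ℓ) :
    0 ≤ polyExpect μ (h * (C ((2 * Mx) ^ 2) - errSq n x0)) := by
  set T : MvPolynomial (Fin n ⊕ Fin dx) ℝ := ∑ k, (X (Sum.inr k) + C (x0 k)) ^ 2 with hT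
  have hTd : T.totalDegree ≤ 2 :=
    totalDegree_finsetSum_le fun k _ => totalDegree_sq_le_of_le <|
      totalDegree_add_le_of_le (totalDegree_X _).le (totalDegree_C_le _)
  have h1 := polyExpect_mul_ball_nonneg hsat hj0 hh hd
  have h2 := polyExpect_nonneg hsat hh (by omega)
  have h3 : 0 ≤ polyExpect μ (h * T) := polyExpect_nonneg hsat (hh.mul (IsSOS.sum_sq _ _))
    (by have := totalDegree_mul_le_of_le (le_refl h.totalDegree) hTd; omega)
  have hr : errSq n x0 = C 2 * ptSq n dx + C (2 * ∑ k, x0 k ^ 2) - T := by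
    simp only [errSq, errVar, ptSq, hT, C_mul, map_sum, Finset.mul_sum,
      ← Finset.sum_add_distrib, ← Finset.sum_sub_distrib, C_pow, map_ofNat]
    exact Finset.sum_congr rfl fun j _ => by ring
  have key : h * (C ((2 * Mx) ^ 2) - errSq n x0) =
      C 2 * (h * (C (Mx ^ 2) - ptSq n dx)) + C (2 * (Mx ^ 2 - ∑ k, x0 k ^ 2)) * h + h * T := by
    rw [hr]
    simp only [C_mul, C_sub, C_pow, map_ofNat]
    ring
  rw [key]
  simp only [map_add, polyExpect_C_mul]
  nlinarith [mul_nonneg (sub_nonneg.2 hx0) h2]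

theorem totalDegree_le_of_ball_mul (hdx : 0 < dx) {M : ℝ} {k : ℕ} {P : MvPolynomial (Fin dx) ℝ}
    (h : (P * (C (M ^ 2) - vnormPoly dx)).totalDegree ≤ k) (hP : P ≠ 0) :
    P.totalDegree + 2 ≤ k := by
  have hc : coeff (Finsupp.single (⟨0, hdx⟩ : Fin dx) 2) (C (M ^ 2) - vnormPoly dx) = -1 := by
    rw [coeff_sub, coeff_C, if_neg (by simp [eq_comm]), vnormPoly, coeff_sum,
      Finset.sum_eq_single ⟨0, hdx⟩]
    · simp [coeff_X_pow]
    · intro b _ hb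
      rw [coeff_X_pow, if_neg]
      intro h
      have := DFunLike.congr_fun h b
      simp [hb.symm] at this
    · simp
  have hne : (C (M ^ 2) - vnormPoly dx) ≠ 0 := by
    intro h0
    rw [h0, coeff_zero] at hc
    norm_num at hc
  have h2 : 2 ≤ (C (M ^ 2) - vnormPoly dx).totalDegree := by
    have := le_totalDegree (p := C (M ^ 2) - vnormPoly dx)
      (s := Finsupp.single (⟨0, hdx⟩ : Fin dx) 2) (by rw [mem_support_iff, hc]; norm_num)
    simpa using this
  rw [totalDegree_mul_of_isDomain hP hne] at h
  omega

/-- A sum-of-squares proof over the ball transfers to the pseudo-expectation of its conclusion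
at any contraction of the error vector. -/
theorem polyExpect_aeval_nonneg_of_sosProof (hsat : PDSatisfies μ ℓ (sysM y A g cbar) 0)
    (hdx : 0 < dx) (hj0 : g j0 = C (Mx ^ 2) - vnormPoly dx) {x0 : Fin dx → ℝ}
    (hx0 : ∑ k, x0 k ^ 2 ≤ Mx ^ 2) {k : ℕ} (hk : k ≤ ℓ) {G : MvPolynomial (Fin dx) ℝ}
    (hG : SosProof (fun _ : Fin 1 => C ((2 * Mx) ^ 2) - vnormPoly dx) k G)
    {c : ℝ} (hc : c ^ 2 ≤ 1) :
    0 ≤ polyExpect μ (aeval (fun k => C c * errVar n x0 k) G) := by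
  obtain ⟨P, hP, hGP, hdeg⟩ := hG
  have hf : ∀ k, (C c * errVar n x0 k).totalDegree ≤ 1 := fun k =>
    totalDegree_C_mul_le c (totalDegree_errVar x0 k)
  rw [hGP, map_sum, map_sum]
  refine Finset.sum_nonneg fun S _ => ?_
  have hdS := hdeg S
  rcases S.eq_empty_or_nonempty with rfl | hS
  · rw [Finset.prod_empty, mul_one] at hdS ⊢
    exact polyExpect_nonneg hsat ((hP ∅).aeval _) ((totalDegree_aeval_le hf _).trans (hdS.trans hk))
  · obtain rfl : S = {0} := by
      obtain ⟨a, ha⟩ := hS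
      ext b
      rw [Subsingleton.elim a 0] at ha
      simp [Subsingleton.elim b 0, ha]
    rw [Finset.prod_singleton] at hdS ⊢
    by_cases h0 : P {0} = 0
    · simp [h0]
    have hd := totalDegree_le_of_ball_mul hdx hdS h0
    have hd' := totalDegree_aeval_le hf (P {0})
    have hs := (hP {0}).aeval (fun k => C c * errVar n x0 k)
    have h1 := polyExpect_mul_errSq_ball_nonneg hsat hj0 hx0 hs (by omega)
    have h2 := polyExpect_nonneg hsat hs (by omega)
    set Q := aeval (fun k => C c * errVar n x0 k) (P {0})
    have hv : aeval (fun k => C c * errVar n x0 k) (vnormPoly dx) = C (c ^ 2) * errSq n x0 := by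
      simp only [vnormPoly, errSq, map_sum, map_pow, aeval_X, mul_pow, Finset.mul_sum]
    have key : aeval (fun k => C c * errVar n x0 k)
        (P {0} * (C ((2 * Mx) ^ 2) - vnormPoly dx)) =
        C (c ^ 2) * (Q * (C ((2 * Mx) ^ 2) - errSq n x0)) +
          C ((1 - c ^ 2) * (2 * Mx) ^ 2) * Q := by
      rw [map_mul, map_sub, hv, aeval_C, algebraMap_eq]
      simp only [C_mul, C_sub, C_1]
      ring
    rw [key, map_add, polyExpect_C_mul, polyExpect_C_mul]
    have := mul_nonneg (sub_nonneg.2 hc) (sq_nonneg (2 * Mx))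
    positivity

end Ball

end Setup

section Estimates

variable {n dx dy mX : ℕ} {y : Fin n → Fin dy → ℝ} {A : Fin n → Matrix (Fin dx) (Fin dy) ℝ}
  {g : Fin mX → MvPolynomial (Fin dx) ℝ} {cbar : ℝ} {ℓ : ℕ}
  {μ : (Fin n ⊕ Fin dx → ℝ) →₀ ℝ}

theorem polyExpect_sq_mul_eq (hsat : PDSatisfies μ ℓ (sysM y A g cbar) 0)
    {h : MvPolynomial (Fin n ⊕ Fin dx) ℝ} (hh : IsSOS h) (hd : h.totalDegree + 2 ≤ ℓ)
    (i : Fin n) : polyExpect μ (indVar dx i ^ 2 * h) = polyExpect μ (indVar dx i * h) := by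
  have h1 := polyExpect_bool_sos hsat hh hd i
  rw [show h * (indVar dx i - indVar dx i ^ 2) = indVar dx i * h - indVar dx i ^ 2 * h by ring,
    map_sub] at h1
  linarith

theorem polyExpect_indVar_nonneg (hsat : PDSatisfies μ ℓ (sysM y A g cbar) 0) (hℓ : 2 ≤ ℓ)
    (i : Fin n) : 0 ≤ polyExpect μ (indVar dx i) := by
  simpa using polyExpect_ind_mul_nonneg hsat IsSOS.one (by simpa using hℓ) i

theorem polyExpect_indVar_le_one (hsat : PDSatisfies μ ℓ (sysM y A g cbar) 0) (hℓ : 2 ≤ ℓ)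
    (h1 : polyExpect μ 1 = 1) (i : Fin n) : polyExpect μ (indVar dx i) ≤ 1 := by
  have h := polyExpect_one_sub_ind_mul_nonneg hsat IsSOS.one (by simpa using hℓ) i
  rw [mul_one, map_sub, h1] at h
  linarith

/-- Nonnegativity of a quadratic form in two variables bounds its off-diagonal entry. -/
theorem sq_le_mul_of_forall_quadratic_nonneg {a b c : ℝ}
    (h : ∀ s t : ℝ, 0 ≤ s ^ 2 * a + 2 * (s * t) * b + t ^ 2 * c) : b ^ 2 ≤ a * c := by
  have := discrim_le_zero (a := a) (b := 2 * b) (c := c) fun s => by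
    have := h s 1
    linarith
  rw [discrim] at this
  linarith

theorem sq_polyExpect_ind_mul_le (hsat : PDSatisfies μ ℓ (sysM y A g cbar) 0) (hℓ : 2 ≤ ℓ)
    (x0 : Fin dx → ℝ) (i : Fin n) (k : Fin dx) :
    polyExpect μ (indVar dx i * errVar n x0 k) ^ 2 ≤
      polyExpect μ (indVar dx i) * polyExpect μ (errVar n x0 k ^ 2) := by
  have hw := polyExpect_sq_mul_eq (A := A) (dx := dx) hsat IsSOS.one (by simpa using hℓ) i
  rw [mul_one, mul_one] at hw
  rw [← hw]
  refine sq_le_mul_of_forall_quadratic_nonneg fun s t => ?_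
  have h := polyExpect_nonneg hsat (IsSOS.sq (C s * indVar dx i + C t * errVar n x0 k))
    ((totalDegree_sq_le_of_le (totalDegree_add_le_of_le
      (totalDegree_C_mul_le s (totalDegree_indVar i))
      (totalDegree_C_mul_le t (totalDegree_errVar x0 k)))).trans hℓ)
  rw [show (C s * indVar dx i + C t * errVar n x0 k) ^ 2 = C (s ^ 2) * indVar dx i ^ 2 +
      C (2 * (s * t)) * (indVar dx i * errVar n x0 k) + C (t ^ 2) * errVar n x0 k ^ 2 by
    simp only [C_mul, C_pow, map_ofNat]; ring] at h
  simpa only [map_add, polyExpect_C_mul] using h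

theorem sq_polyExpect_ind_mul_le_ind (hsat : PDSatisfies μ ℓ (sysM y A g cbar) 0) (hℓ : 4 ≤ ℓ)
    (x0 : Fin dx → ℝ) (i : Fin n) (k : Fin dx) :
    polyExpect μ (indVar dx i * errVar n x0 k) ^ 2 ≤
      polyExpect μ (indVar dx i) * polyExpect μ (indVar dx i * errVar n x0 k ^ 2) := by
  refine sq_le_mul_of_forall_quadratic_nonneg fun s t => ?_
  have h := polyExpect_ind_mul_nonneg hsat (IsSOS.sq (C s + C t * errVar n x0 k))
    (le_trans (add_le_add_left (totalDegree_sq_le_of_le (totalDegree_add_le_of_le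
      (totalDegree_C_le s) (totalDegree_C_mul_le t (totalDegree_errVar x0 k)))) 2) hℓ) i
  rw [show indVar dx i * (C s + C t * errVar n x0 k) ^ 2 = C (s ^ 2) * indVar dx i +
      C (2 * (s * t)) * (indVar dx i * errVar n x0 k) +
      C (t ^ 2) * (indVar dx i * errVar n x0 k ^ 2) by
    simp only [C_mul, C_pow, map_ofNat]; ring] at h
  simpa only [map_add, polyExpect_C_mul] using h

/-- Expansion of `E ‖Q v - τ ω v‖² ≥ 0`. -/
theorem polyExpect_errSq_mul_sq_ge (hsat : PDSatisfies μ ℓ (sysM y A g cbar) 0)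
    (x0 : Fin dx → ℝ) (i : Fin n) {Q : MvPolynomial (Fin n ⊕ Fin dx) ℝ} {d : ℕ}
    (hQ : Q.totalDegree ≤ d) (hd : 1 ≤ d) (hℓ : 2 * d + 2 ≤ ℓ) (τ : ℝ) :
    2 * τ * polyExpect μ (indVar dx i * (errSq n x0 * Q)) -
        τ ^ 2 * polyExpect μ (indVar dx i * errSq n x0) ≤
      polyExpect μ (errSq n x0 * Q ^ 2) := by
  have hB : (Q - C τ * indVar dx i).totalDegree ≤ d :=
    totalDegree_sub_le_of_le hQ (totalDegree_C_mul_le τ ((totalDegree_indVar i).trans hd))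
  have h := polyExpect_nonneg hsat ((isSOS_errSq x0).mul (IsSOS.sq (Q - C τ * indVar dx i)))
    ((totalDegree_mul_le_of_le (totalDegree_errSq x0) (totalDegree_sq_le_of_le hB)).trans
      (by omega))
  have hw := polyExpect_sq_mul_eq hsat (isSOS_errSq x0)
    ((add_le_add_left (totalDegree_errSq x0) 2).trans (by omega)) i
  rw [show errSq n x0 * (Q - C τ * indVar dx i) ^ 2 = errSq n x0 * Q ^ 2 -
      C (2 * τ) * (indVar dx i * (errSq n x0 * Q)) +
      C (τ ^ 2) * (indVar dx i ^ 2 * errSq n x0) by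
    simp only [C_mul, C_pow, map_ofNat]; ring] at h
  simp only [map_add, map_sub, polyExpect_C_mul, hw] at h
  linarith

/-- A univariate polynomial that is nonnegative on `[0, (2 c̄)²]` has nonnegative weighted
pseudo-expectation at the squared measurement error of an inlier. -/
theorem polyExpect_ind_errSq_aeval_nonneg (hsat : PDSatisfies μ ℓ (sysM y A g cbar) 0)
    (hcbar : 0 < cbar) {x0 : Fin dx → ℝ} {i : Fin n}
    (hi : ∑ j, (y i j - ∑ k, A i k j * x0 k) ^ 2 ≤ cbar ^ 2) {m : ℕ} (hm : 2 ≤ m)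
    (hℓ : 4 * m + 2 ≤ ℓ) {f : Polynomial ℝ} (hdeg : f.natDegree ≤ m)
    (hf : ∀ t ∈ Set.Icc 0 ((2 * cbar) ^ 2), 0 ≤ f.eval t) :
    0 ≤ polyExpect μ (indVar dx i * (errSq n x0 * Polynomial.aeval (measSq A x0 i) f)) := by
  set w := indVar dx i
  set r := errSq n x0
  set s := measSq A x0 i
  have base : ∀ h : MvPolynomial (Fin n ⊕ Fin dx) ℝ, IsSOS h → h.totalDegree ≤ 2 * m →
      0 ≤ polyExpect μ (w * (h * (C ((2 * cbar) ^ 2) - s))) := by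
    intro h hh hd
    have hdw : (w ^ 2 * h).totalDegree ≤ 2 + 2 * m :=
      totalDegree_mul_le_of_le (totalDegree_sq_le_of_le (totalDegree_indVar i)) hd
    have h1 := polyExpect_mul_measSq_nonneg hsat ((IsSOS.sq w).mul hh) (by omega) hi
    have h2 := polyExpect_sq_mul_eq hsat hh (by omega) i
    have h3 := polyExpect_bool hsat (hh.mul (isSOS_measSq A x0 i))
      (totalDegree_mul_le_of_le hd (totalDegree_measSq A x0 i))
      (totalDegree_add_le_of_le totalDegree_one_le (totalDegree_indVar i)) (by omega) i
    rw [show w ^ 2 * h * (C ((2 * cbar) ^ 2) - w * s) =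
      C ((2 * cbar) ^ 2) * (w ^ 2 * h) + h * s * (1 + w) * (w - w ^ 2) - w * (h * s) by ring,
      map_sub, map_add, h3, polyExpect_C_mul, h2] at h1
    rw [show w * (h * (C ((2 * cbar) ^ 2) - s)) =
      C ((2 * cbar) ^ 2) * (w * h) - w * (h * s) by ring, map_sub, polyExpect_C_mul]
    linarith
  let L : Polynomial ℝ →ₗ[ℝ] ℝ :=
    polyExpect μ ∘ₗ LinearMap.mulLeft ℝ (w * r) ∘ₗ (Polynomial.aeval s).toLinearMap
  have hLf : ∀ f, L f = polyExpect μ (w * (r * Polynomial.aeval s f)) := fun f => by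
    simp [L]
  rw [← hLf]
  refine Polynomial.linearMap_nonneg_of_nonneg_on_Icc (by positivity) m L ?_ hdeg hf
  intro a b τ hab
  rw [hLf]
  have hsd := totalDegree_measSq A x0 i
  have hev : Polynomial.aeval s (Polynomial.X ^ a *
      (Polynomial.C ((2 * cbar) ^ 2) - Polynomial.X) ^ b * τ ^ 2) =
      s ^ a * (C ((2 * cbar) ^ 2) - s) ^ b * Polynomial.aeval s τ ^ 2 := by
    simp only [map_mul, map_pow, map_sub, Polynomial.aeval_X, Polynomial.aeval_C, algebraMap_eq]
  rw [hev]
  set u := C ((2 * cbar) ^ 2) - s with hu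
  have hud : u.totalDegree ≤ 2 := totalDegree_sub_le_of_le (totalDegree_C_le _) hsd
  have hpow : ∀ (p : MvPolynomial (Fin n ⊕ Fin dx) ℝ) (c : ℕ), p.totalDegree ≤ 2 →
      (p ^ c).totalDegree ≤ c * 2 := fun p c hp =>
    (totalDegree_pow _ _).trans (Nat.mul_le_mul_left _ hp)
  have hτd : (Polynomial.aeval s τ ^ 2).totalDegree ≤ 2 * (τ.natDegree * 2) :=
    totalDegree_sq_le_of_le ((totalDegree_polynomial_aeval_le s τ).trans
      (Nat.mul_le_mul_left _ hsd))
  have hsa : IsSOS (s ^ a) := by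
    rcases Nat.even_or_odd' a with ⟨c, rfl | rfl⟩
    · rw [mul_comm, pow_mul]; exact IsSOS.sq _
    · rw [pow_succ, mul_comm 2, pow_mul]; exact (IsSOS.sq _).mul (isSOS_measSq A x0 i)
  have hsos : ∀ c : ℕ, IsSOS (r * (s ^ a * u ^ (2 * c) * Polynomial.aeval s τ ^ 2)) := by
    intro c
    rw [mul_comm 2 c, pow_mul]
    exact (isSOS_errSq x0).mul ((hsa.mul (IsSOS.sq _)).mul (IsSOS.sq _))
  have hrd : r.totalDegree ≤ 2 := totalDegree_errSq x0
  rcases Nat.even_or_odd' b with ⟨c, rfl | rfl⟩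
  all_goals
    have := totalDegree_mul_le_of_le hrd (totalDegree_mul_le_of_le
      (totalDegree_mul_le_of_le (hpow s a hsd) (hpow u (2 * c) hud)) hτd)
  · exact polyExpect_ind_mul_nonneg hsat (hsos c) (by omega) i
  · convert base _ (hsos c) (by omega) using 3
    ring

/-- The weighted fourth-order moment of an inlier is controlled by its second-order moments. -/
theorem polyExpect_ind_errSq_measSq_le {Mx : ℝ} {j0 : Fin mX}
    (hsat : PDSatisfies μ ℓ (sysM y A g cbar) 0) (h1 : polyExpect μ 1 = 1)
    (hj0 : g j0 = C (Mx ^ 2) - vnormPoly dx) {x0 : Fin dx → ℝ} {i : Fin n}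
    (hi : ∑ j, (y i j - ∑ k, A i k j * x0 k) ^ 2 ≤ cbar ^ 2) (hℓ : 6 ≤ ℓ) :
    polyExpect μ (indVar dx i * (errSq n x0 * measSq A x0 i)) ≤
      (2 * cbar) ^ 2 * (polyExpect μ (indVar dx i * errSq n x0) +
        (1 - polyExpect μ (indVar dx i)) * Mx ^ 2) := by
  set w := indVar dx i
  set r := errSq n x0 with hr
  set s := measSq A x0 i
  set P : MvPolynomial (Fin n ⊕ Fin dx) ℝ := ptSq n dx with hP
  set c : ℝ := ∑ k, x0 k ^ 2 with hc
  set D : MvPolynomial (Fin n ⊕ Fin dx) ℝ := ∑ k, C (x0 k) * X (Sum.inr k) with hD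
  have hwd : w.totalDegree ≤ 1 := totalDegree_indVar i
  set h : MvPolynomial (Fin n ⊕ Fin dx) ℝ :=
    ∑ k, (X (Sum.inr k) - C (x0 k) * w) ^ 2 with hh
  have hhd : h.totalDegree ≤ 2 :=
    totalDegree_finsetSum_le fun k _ => totalDegree_sq_le_of_le <|
      totalDegree_sub_le_of_le (totalDegree_X _).le (totalDegree_C_mul_le _ hwd)
  have hDd : D.totalDegree ≤ 1 :=
    totalDegree_finsetSum_le fun k _ => totalDegree_C_mul_le _ (totalDegree_X _).le
  have hrexp : r = P - C 2 * D + C c := by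
    simp only [hr, errSq, errVar, hP, ptSq, hD, hc, map_sum, Finset.mul_sum,
      ← Finset.sum_add_distrib, ← Finset.sum_sub_distrib, C_pow, map_ofNat]
    exact Finset.sum_congr rfl fun k _ => by ring
  have hhexp : h = P - C 2 * w * D + C c * w ^ 2 := by
    simp only [hh, hP, ptSq, hD, hc, map_sum, Finset.mul_sum, Finset.sum_mul,
      ← Finset.sum_add_distrib, ← Finset.sum_sub_distrib, C_pow, map_ofNat]
    exact Finset.sum_congr rfl fun k _ => by ring
  have hhs : IsSOS h := IsSOS.sum_sq _ _
  have e1 := polyExpect_mul_measSq_nonneg hsat hhs (by omega) hi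
  have e2 := polyExpect_bool hsat (isSOS_measSq A x0 i) (totalDegree_measSq A x0 i)
    (p := C 2 * D - C c * (1 + w)) (e := 1)
    (totalDegree_sub_le_of_le (totalDegree_C_mul_le _ hDd)
      (totalDegree_C_mul_le _ (totalDegree_add_le_of_le totalDegree_one_le hwd)))
    (by omega) i
  have e3 := polyExpect_one_sub_ind_mul_ball_nonneg hsat hj0 (by omega) i
  have e4 := polyExpect_bool_sos hsat IsSOS.one
    (by rw [totalDegree_one]; omega) i
  have k1 : h * (C ((2 * cbar) ^ 2) - w * s) = C ((2 * cbar) ^ 2) * h -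
      (w * (r * s) + s * (C 2 * D - C c * (1 + w)) * (w - w ^ 2)) := by
    rw [hhexp, hrexp]; ring
  have k2 : h = w * r + (1 - w) * P - C c * (1 * (w - w ^ 2)) := by
    rw [hhexp, hrexp]; ring
  have k3 : (1 - w) * (C (Mx ^ 2) - P) = C (Mx ^ 2) * 1 - C (Mx ^ 2) * w - (1 - w) * P := by
    ring
  rw [k3, map_sub, map_sub, polyExpect_C_mul, polyExpect_C_mul, h1] at e3
  rw [k1, map_sub, map_add, e2, polyExpect_C_mul] at e1
  have k4 := congrArg (polyExpect μ) k2
  rw [map_sub, map_add, polyExpect_C_mul, e4] at k4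
  have : polyExpect μ h ≤
      polyExpect μ (w * r) + (1 - polyExpect μ w) * Mx ^ 2 := by linarith
  have := mul_le_mul_of_nonneg_left this (sq_nonneg (2 * cbar))
  linarith

end Estimates

section SosProof

variable {V : Type*} {f G : MvPolynomial V ℝ} {k : ℕ}

theorem SosProof.eval_nonneg (h : SosProof (fun _ : Fin 1 => f) k G) {v : V → ℝ}
    (hf : 0 ≤ eval v f) : 0 ≤ eval v G := by
  obtain ⟨P, hP, rfl, -⟩ := h
  rw [map_sum]
  refine Finset.sum_nonneg fun S _ => ?_
  rw [map_mul, map_prod]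
  exact mul_nonneg ((hP S).eval_nonneg v) (Finset.prod_nonneg fun _ _ => hf)

theorem SosProof.totalDegree_le (h : SosProof (fun _ : Fin 1 => f) k G) : G.totalDegree ≤ k := by
  obtain ⟨P, -, rfl, hd⟩ := h
  exact totalDegree_finsetSum_le fun S _ => hd S

end SosProof

section AntiConcentration

variable {n dx dy : ℕ} {A : Fin n → Matrix (Fin dx) (Fin dy) ℝ}

theorem eval_vnormPoly (v : Fin dx → ℝ) : eval v (vnormPoly dx) = ∑ k, v k ^ 2 := by
  simp [vnormPoly]

theorem eval_polynomial_aeval {V : Type*} (v : V → ℝ) (s : MvPolynomial V ℝ) (q : Polynomial ℝ) :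
    eval v (Polynomial.aeval s q) = q.eval (eval v s) := by
  rw [Polynomial.aeval_def, Polynomial.hom_eval₂, Polynomial.eval, algebraMap_eq]
  congr 1
  ext
  simp

theorem eval_smul_normAPoly (i : Fin n) (t : ℝ) (v : Fin dx → ℝ) :
    eval (t • v) (normAPoly A i) = t ^ 2 * eval v (normAPoly A i) := by
  simp only [normAPoly, map_sum, map_pow, map_mul, eval_C, eval_X, Pi.smul_apply, smul_eq_mul,
    Finset.mul_sum, ← mul_pow]
  refine Finset.sum_congr rfl fun j _ => ?_
  congr 1
  exact Finset.sum_congr rfl fun k _ => by ring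

theorem sum_smul_sq (t : ℝ) (v : Fin dx → ℝ) :
    ∑ k, (t • v) k ^ 2 = t ^ 2 * ∑ k, v k ^ 2 := by
  simp [mul_pow, Finset.mul_sum]

theorem aeval_smul_errVar_normAPoly (x0 : Fin dx → ℝ) (c : ℝ) (i : Fin n) :
    aeval (fun k => C c * errVar n x0 k) (normAPoly A i) = C (c ^ 2) * measSq A x0 i := by
  simp only [normAPoly, measSq, map_sum, map_pow, map_mul, aeval_X, aeval_C, algebraMap_eq,
    Finset.mul_sum, ← mul_pow]
  refine Finset.sum_congr rfl fun j _ => ?_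
  congr 1
  exact Finset.sum_congr rfl fun k _ => by ring

theorem aeval_smul_errVar_vnormPoly (x0 : Fin dx → ℝ) (c : ℝ) :
    aeval (fun k => C c * errVar n x0 k) (vnormPoly dx) = C (c ^ 2) * errSq n x0 := by
  simp only [vnormPoly, errSq, map_sum, map_pow, aeval_X, mul_pow, Finset.mul_sum]

theorem exists_eval_normAPoly_pos {i : Fin n} (hA : A i ≠ 0) :
    ∃ u : Fin dx → ℝ, 0 < eval u (normAPoly A i) := by
  obtain ⟨a, b, hab⟩ : ∃ a b, A i a b ≠ 0 := by
    by_contra! h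
    exact hA (Matrix.ext h)
  refine ⟨Pi.single a 1, ?_⟩
  simp only [normAPoly, map_sum, map_pow, map_mul, eval_C, eval_X]
  refine Finset.sum_pos' (fun _ _ => sq_nonneg _) ⟨b, Finset.mem_univ b, ?_⟩
  simp only [Pi.single_apply, mul_ite, mul_one, mul_zero, Finset.sum_ite_eq', Finset.mem_univ,
    if_true]
  positivity


/-- Restricting the second anti-concentration inequality to a line on which some measurement
does not vanish bounds the degree of its certificate from below. -/
theorem natDegree_le_of_totalDegree_le {I : Finset (Fin n)} {q : Polynomial ℝ} {k : ℕ} {B c : ℝ}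
    (hc : 0 < c) {i : Fin n} (hi : i ∈ I) (hA : A i ≠ 0) (hq : q.natDegree ≠ 0)
    (hd : (C B - vnormPoly dx *
      (C c * ∑ i ∈ I, Polynomial.aeval (normAPoly A i) q ^ 2)).totalDegree ≤ k) :
    4 * q.natDegree + 2 ≤ k := by
  obtain ⟨u, hu⟩ := exists_eval_normAPoly_pos hA
  have hu2 : 0 < ∑ k, u k ^ 2 := by
    refine (Finset.sum_nonneg fun _ _ => sq_nonneg _).lt_of_ne fun h => hu.ne' ?_
    have h0 : u = 0 := by
      ext k
      have := (Finset.sum_eq_zero_iff_of_nonneg fun _ _ => sq_nonneg _).1 h.symm k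
        (Finset.mem_univ k)
      simpa using this
    simp [h0, normAPoly]
  set m := q.natDegree with hm
  have hline := aeval_natDegree_le _ hd (fun k => Polynomial.C (u k) * Polynomial.X) (n := 1)
    fun k => (Polynomial.natDegree_C_mul_le _ _).trans Polynomial.natDegree_X_le
  have hs : ∀ i, aeval (fun k => Polynomial.C (u k) * Polynomial.X) (normAPoly A i) =
      Polynomial.C (eval u (normAPoly A i)) * Polynomial.X ^ 2 := fun i => by
    simp only [normAPoly, map_sum, map_pow, map_mul, aeval_X, aeval_C, eval_C, eval_X,
      Finset.sum_mul, ← mul_pow, Polynomial.algebraMap_eq, mul_assoc]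
  set N := ∑ k, u k ^ 2 with hN
  have hr : aeval (fun k => Polynomial.C (u k) * Polynomial.X) (vnormPoly dx) =
      Polynomial.C N * Polynomial.X ^ 2 := by
    simp only [vnormPoly, hN, map_sum, map_pow, aeval_X, Finset.sum_mul, mul_pow]
  set Q : Fin n → Polynomial ℝ := fun i =>
    Polynomial.expand ℝ 2 (q.comp (Polynomial.C (eval u (normAPoly A i)) * Polynomial.X)) with hQ
  have hq' : ∀ i, aeval (fun k => Polynomial.C (u k) * Polynomial.X)
      (Polynomial.aeval (normAPoly A i) q) = Q i := fun i => by
    rw [← Polynomial.aeval_algHom_apply, hs]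
    simp only [hQ]
    rw [Polynomial.expand_eq_comp_X_pow,
      Polynomial.comp_assoc, ← Polynomial.comp_eq_aeval]
    simp
  have hQd : ∀ i, (Q i).natDegree ≤ m * 2 := fun i => by
    simp only [hQ]
    rw [Polynomial.natDegree_expand, Polynomial.natDegree_comp]
    have := (Polynomial.natDegree_C_mul_le (eval u (normAPoly A i)) _).trans
      Polynomial.natDegree_X_le
    exact Nat.mul_le_mul_right _ (by simpa using Nat.mul_le_mul_left m this)
  have hQc : ∀ i, (Q i).coeff (m * 2) = q.leadingCoeff * eval u (normAPoly A i) ^ m := fun i => by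
    simp only [hQ]
    rw [Polynomial.coeff_expand_mul two_pos, Polynomial.comp_C_mul_X_coeff]
    rfl
  have hS : (∑ i ∈ I, Q i ^ 2).natDegree ≤ 2 * (m * 2) :=
    Polynomial.natDegree_sum_le_of_forall_le _ _ fun i _ =>
      Polynomial.natDegree_pow_le.trans (Nat.mul_le_mul_left _ (hQd i))
  have hcoeff : (Polynomial.C B - Polynomial.C N * Polynomial.X ^ 2 *
      (Polynomial.C c * ∑ i ∈ I, Q i ^ 2)).coeff (2 * (m * 2) + 2) ≠ 0 := by
    rw [show Polynomial.C N * Polynomial.X ^ 2 *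
      (Polynomial.C c * ∑ i ∈ I, Q i ^ 2) =
      Polynomial.C (N * c) * ((∑ i ∈ I, Q i ^ 2) * Polynomial.X ^ 2) by
        rw [Polynomial.C_mul]; ring, Polynomial.coeff_sub, Polynomial.coeff_C_mul,
      Polynomial.coeff_mul_X_pow, Polynomial.coeff_C, if_neg (by omega), zero_sub, neg_ne_zero,
      Polynomial.finsetSum_coeff]
    refine (mul_pos (mul_pos hu2 hc) ?_).ne'
    refine Finset.sum_pos' (fun i _ => ?_) ⟨i, hi, ?_⟩
    · rw [Polynomial.coeff_pow_of_natDegree_le (hQd i)]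
      exact sq_nonneg _
    · rw [Polynomial.coeff_pow_of_natDegree_le (hQd i), hQc]
      have hl : q.leadingCoeff ≠ 0 := by
        rw [Polynomial.leadingCoeff_ne_zero]
        rintro rfl
        simp at hm
        exact hq hm
      positivity
  have hle := Polynomial.le_natDegree_of_ne_zero hcoeff
  simp only [map_sub, map_mul, map_sum, map_pow, aeval_C, hr, hq', Polynomial.algebraMap_eq]
    at hline
  omega

/-- The anti-concentration bound evaluated along a coordinate ray. -/
theorem pos_of_forall_sum_sq_mul_le (hdx : 0 < dx) {I : Finset (Fin n)} (hI : I.Nonempty)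
    {q : Polynomial ℝ} (hq : q.eval 0 = 1) {M B : ℝ} (hM : 0 < M)
    (h : ∀ v : Fin dx → ℝ, ∑ k, v k ^ 2 ≤ M ^ 2 →
      (∑ k, v k ^ 2) * ∑ i ∈ I, q.eval (eval v (normAPoly A i)) ^ 2 ≤ B) : 0 < B := by
  by_contra! hB
  obtain ⟨i, hi⟩ := hI
  set e : Fin dx → ℝ := Pi.single ⟨0, hdx⟩ 1 with he
  have hen : ∑ k, e k ^ 2 = 1 := by simp [he, Pi.single_apply]
  set F : Polynomial ℝ := q.comp (Polynomial.C (eval e (normAPoly A i)) * Polynomial.X ^ 2)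
    with hF
  have hF0 : F = 0 := by
    refine Polynomial.eq_zero_of_infinite_isRoot F
      ((Set.Ioc_infinite hM).mono fun t ht => ?_)
    have h1 := h (t • e) (by rw [sum_smul_sq, hen, mul_one]; exact pow_le_pow_left₀ ht.1.le ht.2 2)
    simp only [sum_smul_sq, hen, eval_smul_normAPoly, mul_one] at h1
    have ht2 : 0 < t ^ 2 := pow_pos ht.1 2
    have h2 : ∑ i ∈ I, q.eval (t ^ 2 * eval e (normAPoly A i)) ^ 2 ≤ 0 := by
      by_contra! h3
      linarith [mul_pos ht2 h3]
    have h3 := Finset.single_le_sum (fun i _ => sq_nonneg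
      (q.eval (t ^ 2 * eval e (normAPoly A i)))) hi
    have h4 : q.eval (t ^ 2 * eval e (normAPoly A i)) = 0 :=
      pow_eq_zero_iff two_ne_zero |>.1 (le_antisymm (h3.trans h2) (sq_nonneg _))
    change F.eval t = 0
    rw [hF, Polynomial.eval_comp, Polynomial.eval_mul, Polynomial.eval_C, Polynomial.eval_pow,
      Polynomial.eval_X, mul_comm, h4]
  have : F.eval 0 = 1 := by simp [hF, Polynomial.eval_comp, hq]
  simp [hF0] at this

/-- Two evaluations of the anti-concentration bound along a ray, for a linear witness. -/
theorem le_of_forall_sum_linear_sq_mul_le (hdx : 0 < dx) {I : Finset (Fin n)}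
    {b : ℝ} {M B : ℝ}
    (h : ∀ v : Fin dx → ℝ, ∑ k, v k ^ 2 ≤ M ^ 2 →
      (∑ k, v k ^ 2) * ∑ i ∈ I, (1 - b * eval v (normAPoly A i)) ^ 2 ≤ B) :
    I.card * M ^ 2 ≤ 9 * B := by
  set e : Fin dx → ℝ := Pi.single ⟨0, hdx⟩ 1 with he
  have hen : ∑ k, e k ^ 2 = 1 := by simp [he, Pi.single_apply]
  have h1 := h (M • e) (by rw [sum_smul_sq, hen, mul_one])
  have h2 := h ((M / 2) • e) (by rw [sum_smul_sq, hen]; nlinarith [sq_nonneg M])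
  simp only [sum_smul_sq, hen, eval_smul_normAPoly, mul_one] at h1 h2
  have h3 : ∑ i ∈ I, (9 : ℝ) ≤
      ∑ i ∈ I, (18 * (1 - b * ((M / 2) ^ 2 * eval e (normAPoly A i))) ^ 2 +
        9 * (1 - b * (M ^ 2 * eval e (normAPoly A i))) ^ 2) := by
    refine Finset.sum_le_sum fun i _ => ?_
    set x := b * (M ^ 2 * eval e (normAPoly A i))
    rw [show b * ((M / 2) ^ 2 * eval e (normAPoly A i)) = x / 4 by ring]
    nlinarith [sq_nonneg (3 * x - 4)]
  rw [Finset.sum_add_distrib, ← Finset.mul_sum, ← Finset.mul_sum, Finset.sum_const,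
    nsmul_eq_mul] at h3
  have := mul_le_mul_of_nonneg_left h3 (sq_nonneg M)
  nlinarith

theorem abs_le_eval_of_sq_le {q : Polynomial ℝ} (hq : q.eval 0 = 1) {R D : ℝ} (hD : D ≠ 0)
    (h : ∀ t ∈ Set.Icc 0 R, D ^ 2 ≤ q.eval t ^ 2) {t : ℝ} (ht : t ∈ Set.Icc 0 R) :
    |D| ≤ q.eval t := by
  have hpos : 0 < q.eval t := by
    by_contra! hneg
    obtain ⟨z, hz, hz0⟩ := intermediate_value_Icc' ht.1 q.continuous.continuousOn
      (show (0 : ℝ) ∈ Set.Icc (q.eval t) (q.eval 0) from ⟨hneg, by rw [hq]; norm_num⟩)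
    have := h z ⟨hz.1, hz.2.trans ht.2⟩
    rw [show q.eval z = 0 from hz0] at this
    have : 0 < D ^ 2 := by positivity
    linarith
  have := sq_le_sq.1 (h t ht)
  rwa [abs_of_pos hpos] at this

/-- If some measurement matrix is nonzero, the pointwise lower bound for the witness holds on a
whole interval. -/
theorem forall_Icc_sq_le {q : Polynomial ℝ} {δ D : ℝ} {i : Fin n} (hA : A i ≠ 0)
    (h : ∀ v : Fin dx → ℝ, eval v (normAPoly A i) ≤ δ ^ 2 →
      D ^ 2 ≤ q.eval (eval v (normAPoly A i)) ^ 2) :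
    ∀ t ∈ Set.Icc 0 (δ ^ 2), D ^ 2 ≤ q.eval t ^ 2 := by
  intro t ht
  obtain ⟨u, hu⟩ := exists_eval_normAPoly_pos hA
  have hs : eval (√(t / eval u (normAPoly A i)) • u) (normAPoly A i) = t := by
    rw [eval_smul_normAPoly, Real.sq_sqrt (div_nonneg ht.1 hu.le), div_mul_cancel₀ _ hu.ne']
  have := h _ (hs.trans_le ht.2)
  rwa [hs] at this

end AntiConcentration

section Main

variable {n dx dy mX : ℕ} {y : Fin n → Fin dy → ℝ} {A : Fin n → Matrix (Fin dx) (Fin dy) ℝ}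
  {g : Fin mX → MvPolynomial (Fin dx) ℝ} {cbar : ℝ} {ℓ : ℕ}
  {μ : (Fin n ⊕ Fin dx → ℝ) →₀ ℝ} {I : Finset (Fin n)} {x0 : Fin dx → ℝ}

theorem sq_mul_enorm_vEst_le {i : Fin n} (hρ : 0 ≤ polyExpect μ (indVar dx i)) :
    (Eω μ i * _root_.enorm (vEst μ i - x0)) ^ 2 ≤
      ∑ k, polyExpect μ (indVar dx i * errVar n x0 k) ^ 2 := by
  have hE : polyExpect μ (indVar dx i) = Eω μ i := by simp [polyExpect, Eω]
  rcases hρ.eq_or_lt with h0 | hpos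
  · rw [← hE, ← h0, zero_mul, zero_pow two_ne_zero]
    exact Finset.sum_nonneg fun _ _ => sq_nonneg _
  · rw [hE] at hpos
    rw [_root_.enorm, mul_pow, Real.sq_sqrt (Finset.sum_nonneg fun _ _ => sq_nonneg _),
      Finset.mul_sum]
    refine (Finset.sum_congr rfl fun k _ => ?_).le
    have h1 : polyExpect μ (indVar dx i * X (Sum.inr k)) =
        pExpect μ fun z => z (Sum.inl i) * z (Sum.inr k) := by simp [polyExpect]
    rw [errVar, mul_sub, map_sub, mul_comm _ (C _), polyExpect_C_mul, hE, h1, ← mul_pow, vEst,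
      if_pos hpos, Pi.sub_apply, mul_sub, mul_inv_cancel_left₀ hpos.ne', mul_comm (x0 k)]

/-- The second anti-concentration inequality, transferred to the pseudo-expectation. -/
theorem mul_sum_polyExpect_errSq_mul_sq_le {Mx : ℝ} {j0 : Fin mX} {k : ℕ} {q : Polynomial ℝ}
    {B l : ℝ} (hsat : PDSatisfies μ ℓ (sysM y A g cbar) 0) (h1 : polyExpect μ 1 = 1)
    (hdx : 0 < dx) (hj0 : g j0 = C (Mx ^ 2) - vnormPoly dx) (hx0 : ∑ k, x0 k ^ 2 ≤ Mx ^ 2)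
    (hk : k ≤ ℓ) (hI : I.Nonempty)
    (hG : SosProof (fun _ : Fin 1 => C ((2 * Mx) ^ 2) - vnormPoly dx) k
      (C B - vnormPoly dx *
        (C ((I.card : ℝ)⁻¹) * ∑ i ∈ I, Polynomial.aeval (normAPoly A i) q ^ 2)))
    (hl0 : 0 ≤ l) (hl1 : l ≤ 1) :
    l * ∑ i ∈ I, polyExpect μ (errSq n x0 * Polynomial.aeval (C l * measSq A x0 i) q ^ 2) ≤
      I.card * B := by
  have hl : √l ^ 2 = l := Real.sq_sqrt hl0
  have h := polyExpect_aeval_nonneg_of_sosProof hsat hdx hj0 hx0 hk hG (hl.trans_le hl1)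
  have hN : (0 : ℝ) < I.card := by exact_mod_cast hI.card_pos
  simp only [map_sub, map_mul, map_sum, map_pow, aeval_C, ← Polynomial.aeval_algHom_apply,
    aeval_smul_errVar_normAPoly, aeval_smul_errVar_vnormPoly, hl, algebraMap_eq] at h
  rw [show C l * errSq n x0 * (C ((I.card : ℝ)⁻¹) *
      ∑ i ∈ I, Polynomial.aeval (C l * measSq A x0 i) q ^ 2) = C ((I.card : ℝ)⁻¹ * l) *
      ∑ i ∈ I, errSq n x0 * Polynomial.aeval (C l * measSq A x0 i) q ^ 2 by
    rw [C_mul, ← Finset.mul_sum]; ring, polyExpect_C_mul, map_sum,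
    show (C B : MvPolynomial (Fin n ⊕ Fin dx) ℝ) = C B * 1 by rw [mul_one],
    polyExpect_C_mul, h1, mul_one] at h
  rw [mul_assoc, sub_nonneg, inv_mul_le_iff₀ hN] at h
  exact h

theorem sum_polyExpect_ind_errSq_le {q : Polynomial ℝ} {D B : ℝ}
    (hsat : PDSatisfies μ ℓ (sysM y A g cbar) 0) (hm : 1 ≤ q.natDegree)
    (hℓ : 4 * q.natDegree + 2 ≤ ℓ)
    (hii : ∑ i ∈ I, polyExpect μ (errSq n x0 * Polynomial.aeval (measSq A x0 i) q ^ 2) ≤ B)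
    (hgap : ∀ i ∈ I, 0 ≤ polyExpect μ (indVar dx i *
      (errSq n x0 * Polynomial.aeval (measSq A x0 i) (q - Polynomial.C |D|)))) :
    D ^ 2 * ∑ i ∈ I, polyExpect μ (indVar dx i * errSq n x0) ≤ B := by
  refine le_trans ?_ hii
  rw [Finset.mul_sum]
  refine Finset.sum_le_sum fun i hi => ?_
  have h1 := polyExpect_errSq_mul_sq_ge hsat x0 i
    ((totalDegree_polynomial_aeval_le (measSq A x0 i) q).trans
      (Nat.mul_le_mul_left _ (totalDegree_measSq A x0 i))) (by omega) (by omega) |D|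
  have h2 := hgap i hi
  rw [map_sub, Polynomial.aeval_C, algebraMap_eq, show indVar dx i * (errSq n x0 *
    (Polynomial.aeval (measSq A x0 i) q - C |D|)) = indVar dx i * (errSq n x0 *
    Polynomial.aeval (measSq A x0 i) q) - C |D| * (indVar dx i * errSq n x0) by ring,
    map_sub, polyExpect_C_mul] at h2
  have h3 := mul_nonneg (abs_nonneg D) h2
  rw [mul_sub, ← mul_assoc |D| |D|, abs_mul_abs_self] at h3
  rw [sq_abs] at h1
  linarith

theorem exists_scale {κ D : ℝ} (hκ : 0 < κ) (hD : κ ≤ 1 - |D|) :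
    ∃ l : ℝ, 0 < l ∧ l ≤ 1 ∧ l * κ ≤ 1 / 3 ∧ D ^ 2 ≤ l * (1 - l * κ) ^ 2 := by
  have hD2 : D ^ 2 ≤ (1 - κ) ^ 2 := by
    rw [← sq_abs]
    exact pow_le_pow_left₀ (abs_nonneg D) (by linarith) 2
  have hκ1 : κ ≤ 1 := by linarith [abs_nonneg D]
  rcases le_or_gt κ (1 / 3) with h | h
  · exact ⟨1, one_pos, le_rfl, by linarith, by simpa using hD2⟩
  · have hl : 1 / (3 * κ) * κ = 1 / 3 := by field_simp
    refine ⟨1 / (3 * κ), by positivity, ?_, hl.le, ?_⟩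
    · rw [div_le_one (by positivity)]
      linarith
    · rw [hl]
      refine hD2.trans ?_
      rw [div_mul_eq_mul_div, le_div_iff₀ (by positivity)]
      nlinarith [mul_nonneg (sq_nonneg (3 * κ - 1)) (show 0 ≤ 4 - 3 * κ by linarith)]

/-- The linear witness `1 - b t` with `b > 0`. -/
theorem sum_mul_sum_le_of_linear {Mx D T b : ℝ} {j0 : Fin mX}
    (hsat : PDSatisfies μ ℓ (sysM y A g cbar) 0) (h1 : polyExpect μ 1 = 1) (hℓ : 6 ≤ ℓ)
    (hj0 : g j0 = C (Mx ^ 2) - vnormPoly dx)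
    (hinl : ∀ i ∈ I, ∑ j, (y i j - ∑ k, A i k j * x0 k) ^ 2 ≤ cbar ^ 2)
    (hcbar : 0 < cbar) (hb : 0 < b) (hbD : b * (2 * cbar) ^ 2 ≤ 1 - |D|) (hD : D ≠ 0)
    (hB : 4 * Mx ^ 2 ≤ 9 * (T ^ 2 * D ^ 2))
    (hii : ∀ l : ℝ, 0 ≤ l → l ≤ 1 →
      l * ∑ i ∈ I, polyExpect μ (errSq n x0 * (1 - C (l * b) * measSq A x0 i) ^ 2) ≤
        I.card * (T ^ 2 * D ^ 2)) :
    (∑ i ∈ I, polyExpect μ (indVar dx i)) * ∑ i ∈ I, polyExpect μ (indVar dx i * errSq n x0) ≤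
      (I.card * T) ^ 2 := by
  set κ := b * (2 * cbar) ^ 2 with hκ
  obtain ⟨l, hl0, hl1, hlκ, hlD⟩ := exists_scale (by positivity) hbD
  set κ' := l * κ with hκ'
  have hκ'0 : 0 ≤ κ' := by positivity
  have hρ1 := polyExpect_indVar_le_one hsat (by omega) h1
  have hρ0 := polyExpect_indVar_nonneg hsat (by omega)
  have hX0 : ∀ i, 0 ≤ polyExpect μ (indVar dx i * errSq n x0) := fun i =>
    polyExpect_ind_mul_nonneg hsat (isSOS_errSq x0)
      ((add_le_add_left (totalDegree_errSq x0) 2).trans (by omega)) i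
  have hterm : ∀ i ∈ I, (1 - κ') ^ 2 * polyExpect μ (indVar dx i * errSq n x0) -
      2 * (1 - κ') * κ' * Mx ^ 2 * (1 - polyExpect μ (indVar dx i)) ≤
      polyExpect μ (errSq n x0 * (1 - C (l * b) * measSq A x0 i) ^ 2) := by
    intro i hi
    have e1 := polyExpect_errSq_mul_sq_ge hsat x0 i (Q := 1 - C (l * b) * measSq A x0 i)
      (totalDegree_sub_le_of_le totalDegree_one_le
        (totalDegree_C_mul_le _ (totalDegree_measSq A x0 i))) (by norm_num) (by omega) (1 - κ')
    have e2 := polyExpect_ind_errSq_measSq_le hsat h1 hj0 (hinl i hi) hℓ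
    rw [show indVar dx i * (errSq n x0 * (1 - C (l * b) * measSq A x0 i)) =
      indVar dx i * errSq n x0 - C (l * b) * (indVar dx i * (errSq n x0 * measSq A x0 i)) by ring,
      map_sub, polyExpect_C_mul] at e1
    have e3 := mul_le_mul_of_nonneg_left e2
      (show 0 ≤ 2 * (1 - κ') * (l * b) from mul_nonneg (by linarith) (by positivity))
    rw [show 2 * (1 - κ') * (l * b) * ((2 * cbar) ^ 2 *
        (polyExpect μ (indVar dx i * errSq n x0) +
          (1 - polyExpect μ (indVar dx i)) * Mx ^ 2)) =
        2 * (1 - κ') * κ' * (polyExpect μ (indVar dx i * errSq n x0) +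
          (1 - polyExpect μ (indVar dx i)) * Mx ^ 2) by rw [hκ', hκ]; ring] at e3
    linarith
  have hsum := mul_le_mul_of_nonneg_left (Finset.sum_le_sum hterm) hl0.le
  rw [Finset.sum_sub_distrib, ← Finset.mul_sum, ← Finset.mul_sum, Finset.sum_sub_distrib,
    Finset.sum_const, nsmul_eq_mul, mul_one] at hsum
  have hmain := hsum.trans (hii l hl0.le hl1)
  set Sρ := ∑ i ∈ I, polyExpect μ (indVar dx i) with hSρ
  set SX := ∑ i ∈ I, polyExpect μ (indVar dx i * errSq n x0) with hSX
  have hSρ0 : 0 ≤ Sρ := Finset.sum_nonneg fun i _ => hρ0 i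
  have hSX0 : 0 ≤ SX := Finset.sum_nonneg fun i _ => hX0 i
  have hSρ1 : Sρ ≤ I.card := by
    simpa using Finset.sum_le_sum fun i (_ : i ∈ I) => hρ1 i
  set N : ℝ := (I.card : ℝ)
  set B := T ^ 2 * D ^ 2 with hBdef
  have hB0 : 0 ≤ B := by positivity
  have hfac : l * (2 * (1 - κ') * κ' * Mx ^ 2) ≤ B := by
    have a1 : 2 * (1 - κ') * κ' ≤ 4 / 9 := by nlinarith
    have a2 : 0 ≤ 2 * (1 - κ') * κ' := mul_nonneg (by linarith) hκ'0
    have a3 : 2 * (1 - κ') * κ' * Mx ^ 2 ≤ 4 / 9 * Mx ^ 2 :=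
      mul_le_mul_of_nonneg_right a1 (sq_nonneg Mx)
    have a4 := mul_le_mul hl1 a3 (mul_nonneg a2 (sq_nonneg Mx)) zero_le_one
    linarith
  have b1 := mul_le_mul_of_nonneg_right hfac (sub_nonneg.2 hSρ1)
  have b2 : D ^ 2 * SX ≤ B * (2 * N - Sρ) := by
    have := mul_le_mul_of_nonneg_right hlD hSX0
    nlinarith
  have b3 := mul_le_mul_of_nonneg_left b2 hSρ0
  have b4 : B * ((2 * N - Sρ) * Sρ) ≤ B * N ^ 2 :=
    mul_le_mul_of_nonneg_left (by nlinarith [sq_nonneg (N - Sρ)]) hB0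
  have hD2 : 0 < D ^ 2 := by positivity
  refine le_of_mul_le_mul_left ?_ hD2
  rw [hBdef] at b3 b4
  nlinarith

end Main

/-- Under certifiable anti-concentration of the inliers, every pseudo-distribution
of level at least `k` satisfying `M_{ω,x}` at degree `0` obeys
`(1/|I|)·∑_{i∈I} Ẽ[ω_i]·‖v_i − x°‖ ≤ α·η·M_x/2`. -/
theorem weighted_estimates_close
    {n dx dy mX : ℕ} (hn : 0 < n) (hdx : 0 < dx) (hdy : 0 < dy)
    (y : Fin n → Fin dy → ℝ) (A : Fin n → Matrix (Fin dx) (Fin dy) ℝ)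
    (g : Fin mX → MvPolynomial (Fin dx) ℝ)
    (Mx : ℝ) (hMx : 0 < Mx)
    (j0 : Fin mX) (hj0 : g j0 = C (Mx ^ 2) - vnormPoly dx)
    (x0 : Fin dx → ℝ) (hx0 : ∀ j, 0 ≤ MvPolynomial.eval x0 (g j))
    (cbar : ℝ) (hcbar : 0 < cbar)
    (α : ℝ) (hα0 : 0 < α) (hα1 : α ≤ 1)
    (I : Finset (Fin n)) (hIcard : (I.card : ℝ) = α * n)
    (hinlier : ∀ i ∈ I, _root_.enorm (fun j => y i j - ∑ k, A i k j * x0 k) ≤ cbar)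
    (η : ℝ) (hη : 0 < η)
    (k : ℕ) (hk : 0 < k) (hke : Even k)
    (hAC : AntiConcentrated A I k
      (α ^ 2 * η ^ 2 * (1 - 2 * cbar) ^ 2 / (32 * cbar)) (2 * cbar) (2 * Mx))
    (ℓ : ℕ) (hℓ : k ≤ ℓ)
    (μ : (Fin n ⊕ Fin dx → ℝ) →₀ ℝ)
    (hpd : IsPseudoDist μ ℓ)
    (hsat : PDSatisfies μ ℓ (sysM y A g cbar) 0) :
    (I.card : ℝ)⁻¹ * ∑ i ∈ I, Eω μ i * _root_.enorm (vEst μ i - x0) ≤ α * η * Mx / 2 := by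
  obtain ⟨p, q, hpq, hp0, hAi, hAii⟩ := hAC
  have hq0 : q.eval 0 = 1 := by rw [← hp0, hpq]; simp
  have hn' : (0 : ℝ) < n := by exact_mod_cast hn
  have hN : (0 : ℝ) < I.card := by rw [hIcard]; positivity
  have hI : I.Nonempty := Finset.card_pos.1 (by exact_mod_cast hN)
  obtain ⟨i0, hi0⟩ := hI
  have h1 : polyExpect μ 1 = 1 := by simpa [polyExpect, pExpect] using hpd.1
  have hx0' : ∑ k, x0 k ^ 2 ≤ Mx ^ 2 := by
    have := hx0 j0
    rw [hj0, map_sub, eval_C, eval_vnormPoly] at this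
    linarith
  have hinl : ∀ i ∈ I, ∑ j, (y i j - ∑ k, A i k j * x0 k) ^ 2 ≤ cbar ^ 2 := fun i hi =>
    (Real.sqrt_le_left hcbar.le).1 (hinlier i hi)
  set D := 1 - 2 * cbar with hD
  set T := α * η * Mx / 2 with hT
  have hT0 : 0 ≤ T := by positivity
  have hB : α ^ 2 * η ^ 2 * D ^ 2 / (32 * cbar) * (2 * cbar) * (2 * Mx) ^ 2 =
      T ^ 2 * D ^ 2 := by
    rw [hT]
    field_simp
    ring
  rw [hB] at hAii
  have hbound : ∀ v : Fin dx → ℝ, ∑ k, v k ^ 2 ≤ (2 * Mx) ^ 2 →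
      (∑ k, v k ^ 2) * ∑ i ∈ I, q.eval (eval v (normAPoly A i)) ^ 2 ≤
        I.card * (T ^ 2 * D ^ 2) := by
    intro v hv
    have h := hAii.eval_nonneg (v := v) (by
      rw [map_sub, eval_C, eval_vnormPoly]
      linarith)
    simp only [map_sub, map_mul, map_sum, map_pow, eval_C, eval_vnormPoly,
      eval_polynomial_aeval] at h
    rw [mul_left_comm, sub_nonneg, inv_mul_le_iff₀ hN] at h
    simpa using h
  have hlow : ∀ i ∈ I, ∀ v : Fin dx → ℝ, eval v (normAPoly A i) ≤ (2 * cbar) ^ 2 →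
      D ^ 2 ≤ q.eval (eval v (normAPoly A i)) ^ 2 := by
    intro i hi v hv
    have h := (hAi i hi).eval_nonneg (v := v) (by
      rw [map_sub, eval_C]
      linarith)
    rw [map_sub, map_pow, eval_C, eval_polynomial_aeval] at h
    linarith
  have hBpos := pos_of_forall_sum_sq_mul_le hdx ⟨i0, hi0⟩ hq0 (by positivity) hbound
  have hD0 : D ≠ 0 := by
    rintro h
    simp [h] at hBpos
  have hD1 : D ^ 2 ≤ 1 := by
    have h0 : eval 0 (normAPoly A i0) = 0 := by simp [normAPoly]
    have := hlow i0 hi0 0 (by rw [h0]; positivity)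
    rwa [h0, hq0, one_pow] at this
  have hk2 : 2 ≤ k := by
    obtain ⟨c, rfl⟩ := hke
    omega
  have hℓ2 : 2 ≤ ℓ := hk2.trans hℓ
  have hii : ∀ l : ℝ, 0 ≤ l → l ≤ 1 →
      l * ∑ i ∈ I, polyExpect μ (errSq n x0 * Polynomial.aeval (C l * measSq A x0 i) q ^ 2) ≤
        I.card * (T ^ 2 * D ^ 2) := fun l hl0 hl1 =>
    mul_sum_polyExpect_errSq_mul_sq_le hsat h1 hdx hj0 hx0' hℓ ⟨i0, hi0⟩ hAii hl0 hl1
  have hρ0 := polyExpect_indVar_nonneg hsat hℓ2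
  have hρ1 := polyExpect_indVar_le_one hsat hℓ2 h1
  have hSρ0 : 0 ≤ ∑ i ∈ I, polyExpect μ (indVar dx i) := Finset.sum_nonneg fun i _ => hρ0 i
  have hSρ1 : ∑ i ∈ I, polyExpect μ (indVar dx i) ≤ I.card := by
    simpa using Finset.sum_le_sum fun i (_ : i ∈ I) => hρ1 i
  suffices ∃ S : Fin n → ℝ, (∀ i ∈ I, 0 ≤ S i) ∧
      (∀ i ∈ I, ∑ k, polyExpect μ (indVar dx i * errVar n x0 k) ^ 2 ≤
        polyExpect μ (indVar dx i) * S i) ∧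
      (∑ i ∈ I, polyExpect μ (indVar dx i)) * ∑ i ∈ I, S i ≤ (I.card * T) ^ 2 by
    obtain ⟨S, hS0, hS, hprod⟩ := this
    rw [inv_mul_le_iff₀ hN]
    refine le_of_sq_le_sq ?_ (by positivity)
    refine le_trans ?_ hprod
    exact Finset.sum_sq_le_sum_mul_sum_of_sq_le_mul I (fun i _ => hρ0 i) hS0
      fun i hi => (sq_mul_enorm_vEst_le (hρ0 i)).trans (hS i hi)
  by_cases htriv : ∀ i ∈ I, Polynomial.aeval (C 1 * measSq A x0 i) q = 1
  · have h := hii 1 zero_le_one le_rfl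
    rw [Finset.sum_congr rfl fun i hi => by rw [htriv i hi, one_pow, mul_one], Finset.sum_const,
      nsmul_eq_mul, one_mul] at h
    have hr0 : 0 ≤ polyExpect μ (errSq n x0) :=
      polyExpect_nonneg hsat (isSOS_errSq x0) ((totalDegree_errSq x0).trans hℓ2)
    refine ⟨fun _ => polyExpect μ (errSq n x0), fun _ _ => hr0, fun i _ => ?_, ?_⟩
    · rw [errSq, map_sum, Finset.mul_sum]
      exact Finset.sum_le_sum fun k _ => sq_polyExpect_ind_mul_le hsat hℓ2 x0 i k
    · rw [Finset.sum_const, nsmul_eq_mul]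
      have h3 : T ^ 2 * D ^ 2 ≤ T ^ 2 := mul_le_of_le_one_right (sq_nonneg T) hD1
      calc (∑ i ∈ I, polyExpect μ (indVar dx i)) * (I.card * polyExpect μ (errSq n x0))
          ≤ I.card * (I.card * T ^ 2) := mul_le_mul hSρ1
            (h.trans (mul_le_mul_of_nonneg_left h3 hN.le)) (mul_nonneg hN.le hr0) hN.le
        _ = (I.card * T) ^ 2 := by ring
  push Not at htriv
  obtain ⟨j, hj, hjq⟩ := htriv
  have hq1 : q.natDegree ≠ 0 := by
    intro h
    rw [Polynomial.eq_C_of_natDegree_eq_zero h] at hjq hq0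
    rw [Polynomial.eval_C] at hq0
    simp [hq0] at hjq
  have hAj : A j ≠ 0 := by
    intro h
    refine hjq ?_
    have hs : measSq A x0 j = C 0 := by simp [measSq, h]
    rw [hs, ← C_mul, mul_zero, ← algebraMap_eq, Polynomial.aeval_algebraMap_apply,
      Polynomial.coe_aeval_eq_eval, hq0, map_one]
  have hdeg : 4 * q.natDegree + 2 ≤ ℓ :=
    (natDegree_le_of_totalDegree_le (inv_pos.2 hN) hj hAj hq1 hAii.totalDegree_le).trans hℓ
  have hge : ∀ t ∈ Set.Icc 0 ((2 * cbar) ^ 2), |D| ≤ q.eval t := fun t ht =>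
    abs_le_eval_of_sq_le hq0 hD0 (forall_Icc_sq_le hAj (hlow j hj)) ht
  have hX0 : ∀ i, 0 ≤ polyExpect μ (indVar dx i * errSq n x0) := fun i =>
    polyExpect_ind_mul_nonneg hsat (isSOS_errSq x0)
      ((add_le_add_left (totalDegree_errSq x0) 2).trans (by omega)) i
  refine ⟨fun i => polyExpect μ (indVar dx i * errSq n x0), fun i _ => hX0 i, fun i _ => ?_, ?_⟩
  · beta_reduce
    rw [errSq, Finset.mul_sum, map_sum, Finset.mul_sum]
    exact Finset.sum_le_sum fun k _ => sq_polyExpect_ind_mul_le_ind hsat (by omega) x0 i k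
  have hgap : (∀ i ∈ I, 0 ≤ polyExpect μ (indVar dx i *
      (errSq n x0 * Polynomial.aeval (measSq A x0 i) (q - Polynomial.C |D|)))) →
      (∑ i ∈ I, polyExpect μ (indVar dx i)) *
        ∑ i ∈ I, polyExpect μ (indVar dx i * errSq n x0) ≤ (I.card * T) ^ 2 := by
    intro h
    have h2 := hii 1 zero_le_one le_rfl
    simp only [C_1, one_mul] at h2
    have h3 := sum_polyExpect_ind_errSq_le hsat (by omega) hdeg h2 h
    have h4 : ∑ i ∈ I, polyExpect μ (indVar dx i * errSq n x0) ≤ I.card * T ^ 2 := by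
      refine le_of_mul_le_mul_left ?_ (show 0 < D ^ 2 by positivity)
      linarith
    calc _ ≤ (I.card : ℝ) * (I.card * T ^ 2) :=
          mul_le_mul hSρ1 h4 (Finset.sum_nonneg fun i _ => hX0 i) hN.le
      _ = (I.card * T) ^ 2 := by ring
  rcases Nat.lt_or_ge q.natDegree 2 with hm | hm
  swap
  · refine hgap fun i hi => polyExpect_ind_errSq_aeval_nonneg hsat hcbar (hinl i hi) hm hdeg
      ((Polynomial.natDegree_sub_C).le) fun t ht => ?_
    rw [Polynomial.eval_sub, Polynomial.eval_C, sub_nonneg]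
    exact hge t ht
  obtain ⟨b, rfl⟩ : ∃ b : ℝ, q = Polynomial.C 1 - Polynomial.C b * Polynomial.X := by
    have h := Polynomial.eq_X_add_C_of_natDegree_le_one (show q.natDegree ≤ 1 by omega)
    have h0 : q.coeff 0 = 1 := by rw [Polynomial.coeff_zero_eq_eval_zero, hq0]
    refine ⟨-q.coeff 1, ?_⟩
    rw [h0] at h
    rw [Polynomial.C_neg]
    linear_combination h
  rcases le_or_gt b 0 with hb | hb
  · refine hgap fun i _ => ?_
    have e1 := hX0 i
    have e2 := polyExpect_ind_mul_nonneg hsat ((isSOS_errSq x0).mul (isSOS_measSq A x0 i))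
      ((add_le_add_left (totalDegree_mul_le_of_le (totalDegree_errSq x0)
        (totalDegree_measSq A x0 i)) 2).trans (by omega)) i
    have e3 : |D| ≤ 1 := by
      rw [← sq_le_one_iff_abs_le_one]
      exact hD1
    simp only [map_sub, map_mul, Polynomial.aeval_C, Polynomial.aeval_X, algebraMap_eq]
    rw [show indVar dx i * (errSq n x0 * (C 1 - C b * measSq A x0 i - C |D|)) =
      C (1 - |D|) * (indVar dx i * errSq n x0) +
        C (-b) * (indVar dx i * (errSq n x0 * measSq A x0 i)) by
      rw [C_sub, C_neg]; ring, map_add, polyExpect_C_mul, polyExpect_C_mul]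
    exact add_nonneg (mul_nonneg (by linarith) e1) (mul_nonneg (by linarith) e2)
  · have hcheb := le_of_forall_sum_linear_sq_mul_le hdx (b := b) (by simpa using hbound)
    refine sum_mul_sum_le_of_linear hsat h1 (by omega) hj0 hinl hcbar hb ?_ hD0 ?_ ?_
    · have := hge _ ⟨by positivity, le_rfl⟩
      simp at this
      linarith
    · refine le_of_mul_le_mul_left ?_ hN
      linarith
    · intro l hl0 hl1
      have := hii l hl0 hl1
      simpa [mul_assoc, mul_left_comm] using this
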